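/- Let k be a field of characteristic 0 and q ∈ k nonzero, either generic (not a root of unity) or a primitive m-th root of unity. For 1 ≤ r ≤ n−1, the natural map π: A_{n,r} → M^{r+1}_q(n) induces an isomorphism of k-algebras A_{n,r}[d^{−1}] ≅ M^{r+1}_q(n)[d^{−1}], where both sides denote localization at the Ore set S = {q^{−i}d^{j} : i, j ∈ ℕ} (respectively its image π(S)). -/

import Mathlib

open scoped BigOperators

/-- Defining relations of the quantized matrix algebra `M_q(n,r)` (generators `Z (i,j)`). -/
inductive QMatRel (k : Type) [Field k] (q : k) (n r : ℕ) :
    FreeAlgebra k (Fin n × Fin r) → FreeAlgebra k (Fin n × Fin r) → Prop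
  | row (i : Fin n) (j l : Fin r) (h : j < l) :
      QMatRel k q n r (FreeAlgebra.ι k (i, j) * FreeAlgebra.ι k (i, l))
        (q • (FreeAlgebra.ι k (i, l) * FreeAlgebra.ι k (i, j)))
  | col (i s : Fin n) (j : Fin r) (h : i < s) :
      QMatRel k q n r (FreeAlgebra.ι k (i, j) * FreeAlgebra.ι k (s, j))
        (q • (FreeAlgebra.ι k (s, j) * FreeAlgebra.ι k (i, j)))
  | cross (i s : Fin n) (j l : Fin r) (h1 : i < s) (h2 : l < j) :
      QMatRel k q n r (FreeAlgebra.ι k (i, j) * FreeAlgebra.ι k (s, l))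
        (FreeAlgebra.ι k (s, l) * FreeAlgebra.ι k (i, j))
  | diag (i s : Fin n) (j l : Fin r) (h1 : i < s) (h2 : j < l) :
      QMatRel k q n r (FreeAlgebra.ι k (i, j) * FreeAlgebra.ι k (s, l))
        (FreeAlgebra.ι k (s, l) * FreeAlgebra.ι k (i, j) +
          (q - q⁻¹) • (FreeAlgebra.ι k (i, l) * FreeAlgebra.ι k (s, j)))

/-- The quantized matrix algebra `M_q(n,r)`. -/
abbrev QMat (k : Type) [Field k] (q : k) (n r : ℕ) : Type := RingQuot (QMatRel k q n r)

/-- The generator `Z_{i,j}` of `M_q(n,r)`. -/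
noncomputable def Zgen (k : Type) [Field k] (q : k) (n r : ℕ) (i : Fin n) (j : Fin r) :
    QMat k q n r :=
  RingQuot.mkAlgHom k (QMatRel k q n r) (FreeAlgebra.ι k (i, j))

/-- Number of inversions (the length) of a permutation. -/
def invCount {t : ℕ} (σ : Equiv.Perm (Fin t)) : ℕ :=
  (Finset.univ.filter (fun p : Fin t × Fin t => p.1 < p.2 ∧ σ p.2 < σ p.1)).card

/-- The `t × t` quantum minor on rows `row 0 < ... < row (t-1)` and columns
`col 0 < ... < col (t-1)`. -/
noncomputable def qMinor (k : Type) [Field k] (q : k) (n r : ℕ) (t : ℕ)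
    (row : Fin t → Fin n) (col : Fin t → Fin r) : QMat k q n r :=
  ∑ σ : Equiv.Perm (Fin t),
    ((-q) ^ invCount σ) • (List.ofFn fun a => Zgen k q n r (row a) (col (σ a))).prod


/-- The set of all `t × t` quantum minors of `M_q(n)` (rows `ro 0 < ... < ro (t-1)`,
columns `co 0 < ... < co (t-1)`). -/
def minorSet (k : Type) [Field k] (q : k) (n t : ℕ) : Set (QMat k q n n) :=
  {x | ∃ ro co : Fin t → Fin n, StrictMono ro ∧ StrictMono co ∧ x = qMinor k q n n t ro co}

/-- The relation identifying every `t × t` quantum minor of `M_q(n)` with `0`; the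
corresponding `RingQuot` is the quotient of `M_q(n)` by the two-sided ideal `I^t_q`
generated by all `t × t` quantum minors. -/
def minorRel (k : Type) [Field k] (q : k) (n t : ℕ) :
    QMat k q n n → QMat k q n n → Prop :=
  fun a b => a ∈ minorSet k q n t ∧ b = 0

/-- The quantized function algebra `M^{r+1}_q(n) = M_q(n) / I^{r+1}_q` of rank `r`
matrices. -/
abbrev QMatRank (k : Type) [Field k] (q : k) (n r : ℕ) : Type :=
  RingQuot (minorRel k q n (r + 1))

/-- The quotient map `π : M_q(n) → M^{r+1}_q(n)`. -/
noncomputable def rankProj (k : Type) [Field k] (q : k) (n r : ℕ) :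
    QMat k q n n →ₐ[k] QMatRank k q n r :=
  RingQuot.mkAlgHom k (minorRel k q n (r + 1))

/-- The quantum minor `d = d_r`: the `r × r` quantum minor of `M_q(n)` on rows and
columns `1, ..., r`. -/
noncomputable def dMinor (k : Type) [Field k] (q : k) (n r : ℕ) (h : r ≤ n) :
    QMat k q n n :=
  qMinor k q n n r (fun a => Fin.castLE h a) (fun a => Fin.castLE h a)

/-- `q` is either generic (not a root of unity) or a primitive `m`-th root of unity for
some `m ≥ 1`. -/
def GenericOrRootOfUnity (k : Type) [Field k] (q : k) : Prop :=
  (∀ m : ℕ, 0 < m → q ^ m ≠ 1) ∨ ∃ m : ℕ, 0 < m ∧ IsPrimitiveRoot q m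

/-- The subalgebra `A_{n,r}` of `M_q(n)` generated by the `Z_{i,j}` with
`(i,j) ∉ {r+1, ..., n} × {r+1, ..., n}` (0-based: `i < r` or `j < r`). -/
def Asub (k : Type) [Field k] (q : k) (n r : ℕ) : Subalgebra k (QMat k q n n) :=
  Algebra.adjoin k
    {x | ∃ i j : Fin n, ((i : ℕ) < r ∨ (j : ℕ) < r) ∧ x = Zgen k q n n i j}

/-- The set `S = {q^{-i} d^j : i, j ∈ ℕ}` in `M_q(n)`, where `d = d_r`. -/
def powerSet (k : Type) [Field k] (q : k) (n r : ℕ) (h : r ≤ n) : Set (QMat k q n n) :=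
  {x | ∃ i j : ℕ, x = (q⁻¹) ^ i • dMinor k q n r h ^ j}

/-- `f : R → B` realizes `B` as the (left and right) Ore localization of `R` at the
multiplicative set `S`: the elements of `f(S)` are invertible in `B`, every element of
`B` is a left fraction `f(a) f(s)⁻¹` and a right fraction `f(s)⁻¹ f(a)` with `s ∈ S`,
and the kernel of `f` consists of the elements annihilated by some element of `S`. -/
def IsOreLocalization {R B : Type} [Ring R] [Ring B] (f : R →+* B) (S : Set R) : Prop :=
  (∀ s ∈ S, IsUnit (f s)) ∧
  (∀ b : B, ∃ a : R, ∃ s ∈ S, b * f s = f a) ∧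
  (∀ b : B, ∃ a : R, ∃ s ∈ S, f s * b = f a) ∧
  (∀ a : R, f a = 0 → ∃ s ∈ S, a * s = 0 ∨ s * a = 0)

/-- A family `Z i j` in a `k`-algebra satisfies the relations of a quantized matrix algebra. -/
structure IsQMat {k B ι κ : Type*} [Field k] [Ring B] [Algebra k B] [LinearOrder ι]
    [LinearOrder κ] (q : k) (Z : ι → κ → B) : Prop where
  row : ∀ i j l, j < l → Z i j * Z i l = q • (Z i l * Z i j)
  col : ∀ i s j, i < s → Z i j * Z s j = q • (Z s j * Z i j)
  cross : ∀ i s j l, i < s → l < j → Z i j * Z s l = Z s l * Z i j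
  diag : ∀ i s j l, i < s → j < l →
    Z i j * Z s l = Z s l * Z i j + (q - q⁻¹) • (Z i l * Z s j)

theorem IsQMat.transpose {k B ι κ : Type*} [Field k] [Ring B] [Algebra k B] [LinearOrder ι]
    [LinearOrder κ] {q : k} {Z : ι → κ → B} (hZ : IsQMat q Z) :
    IsQMat q (fun j i => Z i j) where
  row _ _ _ h := hZ.col _ _ _ h
  col _ _ _ h := hZ.row _ _ _ h
  cross _ _ _ _ h1 h2 := (hZ.cross _ _ _ _ h2 h1).symm
  diag i s j l h1 h2 := by rw [hZ.diag j l i s h2 h1, hZ.cross j l s i h2 h1]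

theorem IsQMat.submatrix {k B ι κ ι' κ' : Type*} [Field k] [Ring B] [Algebra k B] [LinearOrder ι]
    [LinearOrder κ] [LinearOrder ι'] [LinearOrder κ'] {q : k} {Z : ι → κ → B} (hZ : IsQMat q Z)
    {f : ι' → ι} {g : κ' → κ} (hf : StrictMono f) (hg : StrictMono g) :
    IsQMat q (fun i j => Z (f i) (g j)) where
  row _ _ _ h := hZ.row _ _ _ (hg h)
  col _ _ _ h := hZ.col _ _ _ (hf h)
  cross _ _ _ _ h1 h2 := hZ.cross _ _ _ _ (hf h1) (hg h2)
  diag _ _ _ _ h1 h2 := hZ.diag _ _ _ _ (hf h1) (hg h2)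

/-- The quantum minor expression of a family `Z`, for arbitrary tuples of rows and columns. -/
def genMinor {k B ι κ : Type*} [Field k] [Ring B] [Algebra k B] (q : k) {t : ℕ}
    (Z : ι → κ → B) (row : Fin t → ι) (col : Fin t → κ) : B :=
  ∑ σ : Equiv.Perm (Fin t),
    ((-q) ^ invCount σ) • (List.ofFn fun a => Z (row a) (col (σ a))).prod

theorem exists_ofFn_prod_eq {B : Type*} [Monoid B] (p : ℕ) :
    ∀ {t : ℕ} (hp : p + 1 < t) (f : Fin t → B), ∃ A C : B, ∀ g : Fin t → B,
      (∀ a : Fin t, (a : ℕ) ≠ p → (a : ℕ) ≠ p + 1 → g a = f a) →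
      (List.ofFn g).prod = A * (g ⟨p, by omega⟩ * g ⟨p + 1, hp⟩) * C := by
  induction p with
  | zero =>
    intro t hp f
    obtain ⟨t, rfl⟩ : ∃ u, t = u + 2 := ⟨t - 2, by omega⟩
    refine ⟨1, (List.ofFn fun a : Fin t => f a.succ.succ).prod, fun g hg => ?_⟩
    have h : (fun a : Fin t => g a.succ.succ) = fun a : Fin t => f a.succ.succ :=
      funext fun a => hg _ (by simp) (by simp)
    rw [List.ofFn_succ, List.ofFn_succ, h]
    simp [mul_assoc]
  | succ p ih =>
    intro t hp f
    obtain ⟨t, rfl⟩ : ∃ u, t = u + 1 := ⟨t - 1, by omega⟩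
    obtain ⟨A, C, h⟩ := ih (t := t) (by omega) (fun a => f a.succ)
    refine ⟨f 0 * A, C, fun g hg => ?_⟩
    rw [List.ofFn_succ, List.prod_cons, h (fun a => g a.succ), hg 0 (by simp) (by simp)]
    · simp [mul_assoc]
    · intro a h1 h2
      exact hg _ (by simpa using h1) (by simpa using h2)

theorem invCount_mul_swap {t p : ℕ} (hp : p + 1 < t) (σ : Equiv.Perm (Fin t))
    (h : σ ⟨p, by omega⟩ < σ ⟨p + 1, hp⟩) :
    invCount (σ * Equiv.swap ⟨p, by omega⟩ ⟨p + 1, hp⟩) = invCount σ + 1 := by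
  set x : Fin t := ⟨p, by omega⟩ with hx
  set y : Fin t := ⟨p + 1, hp⟩ with hy
  have hxy : x < y := by simp [hx, hy]
  have key : ∀ a b : Fin t, a < b → ¬ (a = x ∧ b = y) → Equiv.swap x y a < Equiv.swap x y b := by
    intro a b hab hne
    simp only [Equiv.swap_apply_def, Fin.ext_iff, Fin.lt_def, hx, hy] at *
    split_ifs <;> simp_all <;> omega
  unfold invCount
  rw [← Finset.card_insert_of_notMem (a := (y, x))]
  · refine Finset.card_nbij' (fun z => (Equiv.swap x y z.1, Equiv.swap x y z.2))
      (fun z => (Equiv.swap x y z.1, Equiv.swap x y z.2)) ?_ ?_ ?_ ?_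
    · rintro ⟨a, b⟩ hz
      simp only [Finset.mem_coe, Finset.mem_filter, Finset.mem_univ, true_and,
        Finset.mem_insert] at hz ⊢
      simp only [Equiv.Perm.mul_apply] at hz
      by_cases hab : a = x ∧ b = y
      · simp [hab.1, hab.2]
      · simp [key a b hz.1 hab, hz.2]
    · rintro ⟨a, b⟩ hz
      simp only [Finset.mem_coe, Finset.mem_filter, Finset.mem_univ, true_and, Finset.mem_insert,
        Prod.mk.injEq] at hz
      simp only [Finset.mem_coe, Finset.mem_filter, Finset.mem_univ, true_and]
      simp only [Equiv.Perm.mul_apply]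
      rcases hz with ⟨rfl, rfl⟩ | ⟨h1, h2⟩
      · simp [hxy, h]
      · refine ⟨key a b h1 ?_, by simpa using h2⟩
        rintro ⟨rfl, rfl⟩
        exact lt_asymm h h2
    · rintro ⟨a, b⟩ _; simp
    · rintro ⟨a, b⟩ _; simp
  · simp [not_lt_of_gt hxy]

section
variable {k B ι κ : Type*} [Field k] [Ring B] [Algebra k B] [LinearOrder ι] [LinearOrder κ]
  {q : k} {Z : ι → κ → B}

/-- A sum over permutations vanishes as soon as it cancels on pairs differing by an adjacent
transposition. -/
theorem sum_perm_eq_zero_of_swap {t p : ℕ} (hp : p + 1 < t) (f : Equiv.Perm (Fin t) → B)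
    (hf : ∀ σ : Equiv.Perm (Fin t), σ ⟨p, by omega⟩ < σ ⟨p + 1, hp⟩ →
      f σ + f (σ * Equiv.swap ⟨p, by omega⟩ ⟨p + 1, hp⟩) = 0) :
    ∑ σ, f σ = 0 := by
  set x : Fin t := ⟨p, by omega⟩ with hx
  set y : Fin t := ⟨p + 1, hp⟩ with hy
  have hxy : x ≠ y := by simp [hx, hy]
  refine Finset.sum_involution (fun σ _ => σ * Equiv.swap x y) ?_ ?_ ?_ ?_
  · intro σ _
    rcases lt_trichotomy (σ x) (σ y) with h | h | h
    · exact hf σ h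
    · exact absurd (σ.injective h) hxy
    · have := hf (σ * Equiv.swap x y) (by simpa using h)
      rw [mul_assoc, Equiv.swap_mul_self, mul_one] at this
      rw [add_comm]; exact this
  · intro σ _ _ h
    have := congrArg (fun τ => τ x) h
    simp only [Equiv.Perm.mul_apply, Equiv.swap_apply_left] at this
    exact hxy (σ.injective this).symm
  · simp
  · intro σ _; simp [mul_assoc]

theorem genMinor_eq_zero_of_adjacent (hZ : IsQMat q Z) {t p : ℕ} (hp : p + 1 < t)
    (row : Fin t → ι) {col : Fin t → κ} (hcol : StrictMono col)
    (h : row ⟨p, by omega⟩ = row ⟨p + 1, hp⟩) : genMinor q Z row col = 0 := by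
  refine sum_perm_eq_zero_of_swap hp _ fun σ hσ => ?_
  obtain ⟨A, C, hAC⟩ := exists_ofFn_prod_eq p hp (fun a => Z (row a) (col (σ a)))
  rw [invCount_mul_swap hp σ hσ, hAC _ (fun _ _ _ => rfl), hAC]
  · simp only [Equiv.Perm.mul_apply, Equiv.swap_apply_left, Equiv.swap_apply_right, ← h]
    rw [hZ.row _ _ _ (hcol hσ)]
    simp only [mul_smul_comm, smul_mul_assoc, smul_smul, ← add_smul]
    rw [show (-q) ^ invCount σ * q + (-q) ^ (invCount σ + 1) = 0 by ring, zero_smul]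
  · intro a h1 h2
    rw [Equiv.Perm.mul_apply, Equiv.swap_apply_of_ne_of_ne]
    · exact fun h => h1 (by simp [h])
    · exact fun h => h2 (by simp [h])

theorem genMinor_swap (hq : q ≠ 0) (hZ : IsQMat q Z) {t p : ℕ} (hp : p + 1 < t)
    (row : Fin t → ι) {col : Fin t → κ} (hcol : StrictMono col)
    (h : row ⟨p, by omega⟩ < row ⟨p + 1, hp⟩) :
    genMinor q Z (row ∘ Equiv.swap ⟨p, by omega⟩ ⟨p + 1, hp⟩) col
      = (-q) • genMinor q Z row col := by
  rw [← sub_eq_zero]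
  unfold genMinor
  rw [Finset.smul_sum, ← Finset.sum_sub_distrib]
  refine sum_perm_eq_zero_of_swap hp _ fun σ hσ => ?_
  have hsw : ∀ a : Fin t, (a : ℕ) ≠ p → (a : ℕ) ≠ p + 1 →
      Equiv.swap (⟨p, by omega⟩ : Fin t) ⟨p + 1, hp⟩ a = a := by
    intro a h1 h2
    rw [Equiv.swap_apply_of_ne_of_ne]
    · exact fun h => h1 (by simp [h])
    · exact fun h => h2 (by simp [h])
  obtain ⟨A, C, hAC⟩ := exists_ofFn_prod_eq p hp (fun a => Z (row a) (col (σ a)))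
  rw [invCount_mul_swap hp σ hσ, hAC _ (fun _ _ _ => rfl), hAC, hAC, hAC]
  · simp only [Equiv.Perm.mul_apply, Function.comp_apply, Equiv.swap_apply_left,
      Equiv.swap_apply_right]
    rw [hZ.diag _ _ _ _ h (hcol hσ), ← hZ.cross _ _ _ _ h (hcol hσ)]
    simp only [mul_add, add_mul, smul_add, mul_smul_comm, smul_mul_assoc, smul_smul]
    match_scalars
    · field_simp
      ring
    · field_simp
      ring
  all_goals
    intro a h1 h2
    simp only [Equiv.Perm.mul_apply, Function.comp_apply, hsw a h1 h2]

end

theorem invCount_one (t : ℕ) : invCount (1 : Equiv.Perm (Fin t)) = 0 := by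
  unfold invCount
  rw [Finset.card_eq_zero, Finset.filter_eq_empty_iff]
  rintro ⟨a, b⟩ _ ⟨h1, h2⟩
  exact lt_asymm h1 h2

theorem invCount_inv {t : ℕ} (σ : Equiv.Perm (Fin t)) : invCount σ⁻¹ = invCount σ := by
  unfold invCount
  refine Finset.card_nbij' (fun z => (σ⁻¹ z.2, σ⁻¹ z.1)) (fun z => (σ z.2, σ z.1)) ?_ ?_ ?_ ?_
  · rintro ⟨a, b⟩ h
    simp only [Finset.mem_coe, Finset.mem_filter, Finset.mem_univ, true_and] at h ⊢
    simpa using h.symm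
  · rintro ⟨a, b⟩ h
    simp only [Finset.mem_coe, Finset.mem_filter, Finset.mem_univ, true_and] at h ⊢
    simpa using h.symm
  · rintro ⟨a, b⟩ _; simp
  · rintro ⟨a, b⟩ _; simp

theorem invCount_eq_sum {t : ℕ} (σ : Equiv.Perm (Fin t)) :
    invCount σ = ∑ a, ∑ b, if a < b ∧ σ b < σ a then 1 else 0 := by
  unfold invCount
  rw [Finset.card_filter, Fintype.sum_prod_type]

/-- A permutation with at least one inversion has a descent. -/
theorem Equiv.Perm.eq_one_of_no_descent {t : ℕ} (σ : Equiv.Perm (Fin t))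
    (h : ∀ (p : ℕ) (hp : p + 1 < t), σ ⟨p, by omega⟩ < σ ⟨p + 1, hp⟩) : σ = 1 := by
  have hmono : StrictMono σ := by
    cases t with
    | zero => exact fun a => a.elim0
    | succ t => exact Fin.strictMono_iff_lt_succ.2 fun i => h i (by omega)
  have : (σ : Fin t → Fin t) = id :=
    (StrictMono.range_inj hmono strictMono_id).1 (by simp [σ.surjective.range_eq])
  exact Equiv.ext fun a => congrFun this a

/-- The permutation sending `j` to `p` and acting as `e` on the complements. -/
noncomputable def insertPerm {t : ℕ} (j p : Fin (t + 1)) (e : Equiv.Perm (Fin t)) :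
    Equiv.Perm (Fin (t + 1)) :=
  Equiv.ofBijective (j.insertNth p fun i => p.succAbove (e i) : Fin (t + 1) → Fin (t + 1)) <| by
    refine Finite.injective_iff_bijective.1 fun a b => ?_
    rcases Fin.eq_self_or_eq_succAbove j a with ha | ⟨a, rfl⟩ <;>
      rcases Fin.eq_self_or_eq_succAbove j b with hb | ⟨b, rfl⟩
    · simp [ha, hb]
    · simp [ha, Fin.ne_succAbove]
    · simp [hb, Fin.succAbove_ne]
    · simp

@[simp]
theorem insertPerm_same {t : ℕ} (j p : Fin (t + 1)) (e : Equiv.Perm (Fin t)) :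
    insertPerm j p e j = p := by
  simp [insertPerm]

@[simp]
theorem insertPerm_succAbove {t : ℕ} (j p : Fin (t + 1)) (e : Equiv.Perm (Fin t)) (i : Fin t) :
    insertPerm j p e (j.succAbove i) = p.succAbove (e i) := by
  simp [insertPerm]

@[simp]
theorem insertPerm_zero_succ {t : ℕ} (p : Fin (t + 1)) (e : Equiv.Perm (Fin t)) (i : Fin t) :
    insertPerm 0 p e i.succ = p.succAbove (e i) := by
  simpa using insertPerm_succAbove 0 p e i

@[simp]
theorem insertPerm_last_castSucc {t : ℕ} (p : Fin (t + 1)) (e : Equiv.Perm (Fin t)) (i : Fin t) :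
    insertPerm (Fin.last t) p e i.castSucc = p.succAbove (e i) := by
  simpa using insertPerm_succAbove (Fin.last t) p e i

theorem sum_perm_succ {t : ℕ} {B : Type*} [AddCommMonoid B] (j : Fin (t + 1))
    (f : Equiv.Perm (Fin (t + 1)) → B) :
    ∑ σ, f σ = ∑ p, ∑ e, f (insertPerm j p e) := by
  rw [← Fintype.sum_prod_type' fun p e => f (insertPerm j p e)]
  refine (Fintype.sum_bijective (fun x : Fin (t + 1) × Equiv.Perm (Fin t) =>
    insertPerm j x.1 x.2) ?_ _ _ fun _ => rfl).symm
  rw [Fintype.bijective_iff_injective_and_card]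
  constructor
  · rintro ⟨p, e⟩ ⟨p', e'⟩ h
    have hp : p = p' := by simpa using congrArg (fun τ => τ j) h
    subst hp
    refine Prod.ext rfl (Equiv.ext fun i => ?_)
    simpa using congrArg (fun τ => τ (j.succAbove i)) h
  · simp [Fintype.card_perm, Nat.factorial_succ]

theorem Fin.sum_ite_castSucc_lt {t : ℕ} (p : Fin (t + 1)) :
    (∑ m : Fin t, if m.castSucc < p then 1 else 0) = (p : ℕ) := by
  simp only [Fin.lt_def, Fin.val_castSucc]
  rw [Fin.sum_univ_eq_sum_range (fun m => if m < (p : ℕ) then 1 else 0), ← Finset.card_filter,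
    show (Finset.range t).filter (· < (p : ℕ)) = Finset.range p by ext; simp; omega,
    Finset.card_range]

theorem Fin.sum_ite_le_castSucc {t : ℕ} (p : Fin (t + 1)) :
    (∑ m : Fin t, if p ≤ m.castSucc then 1 else 0) = t - (p : ℕ) := by
  have h : (∑ m : Fin t, if p ≤ m.castSucc then 1 else 0) + (p : ℕ) = t := by
    conv_lhs => rw [← Fin.sum_ite_castSucc_lt p, ← Finset.sum_add_distrib]
    rw [Finset.sum_congr rfl (g := fun _ => 1)]
    · simp
    · intro m _
      by_cases hm : p ≤ m.castSucc
      · simp [hm, not_lt_of_ge hm]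
      · simp [hm, lt_of_not_ge hm]
  omega

theorem invCount_insertPerm_zero {t : ℕ} (p : Fin (t + 1)) (e : Equiv.Perm (Fin t)) :
    invCount (insertPerm 0 p e) = p + invCount e := by
  rw [invCount_eq_sum, invCount_eq_sum, Fin.sum_univ_succ]
  simp only [Fin.sum_univ_succ, insertPerm_same, insertPerm_zero_succ, Fin.not_lt_zero,
    Fin.succ_lt_succ_iff, Fin.succ_pos, true_and, false_and, if_false, zero_add, lt_self_iff_false,
    (Fin.strictMono_succAbove p).lt_iff_lt, Fin.succAbove_lt_iff_castSucc_lt]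
  rw [Equiv.sum_comp e (fun m => if m.castSucc < p then 1 else 0), Fin.sum_ite_castSucc_lt]

theorem invCount_insertPerm_last {t : ℕ} (p : Fin (t + 1)) (e : Equiv.Perm (Fin t)) :
    invCount (insertPerm (Fin.last t) p e) = (t - p) + invCount e := by
  rw [invCount_eq_sum, invCount_eq_sum, Fin.sum_univ_castSucc]
  have h : ∀ x : Fin (t + 1), ¬ Fin.last t < x := fun x => not_lt_of_ge (Fin.le_last x)
  simp only [Fin.sum_univ_castSucc, insertPerm_same, insertPerm_last_castSucc, h,
    Fin.castSucc_lt_castSucc_iff, Fin.castSucc_lt_last, true_and, false_and, if_false,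
    (Fin.strictMono_succAbove p).lt_iff_lt, Fin.lt_succAbove_iff_le_castSucc,
    Finset.sum_const_zero, add_zero, Finset.sum_add_distrib]
  rw [Equiv.sum_comp e (fun m => if p ≤ m.castSucc then 1 else 0), Fin.sum_ite_le_castSucc,
    add_comm]

/-- Insertion sort does not change a product if the pairs that get interchanged commute. -/
theorem List.prod_map_insertionSort {α B : Type*} [Monoid B] (r : α → α → Prop) [DecidableRel r]
    (f : α → B) (l : List α)
    (h : l.Pairwise fun x y => ¬ r x y → f x * f y = f y * f x) :
    ((l.insertionSort r).map f).prod = (l.map f).prod := by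
  have key : ∀ (a : α) (l : List α), (∀ y ∈ l, ¬ r a y → f a * f y = f y * f a) →
      ((l.orderedInsert r a).map f).prod = f a * (l.map f).prod := by
    intro a l
    induction l with
    | nil => simp
    | cons b l ih =>
      intro h
      by_cases hab : r a b
      · simp [hab]
      · rw [List.orderedInsert_of_not_le _ _ hab, List.map_cons, List.prod_cons,
          ih fun y hy => h y (List.mem_cons_of_mem _ hy), List.map_cons, List.prod_cons,
          ← mul_assoc, ← mul_assoc, h b List.mem_cons_self hab]
  induction l with
  | nil => simp
  | cons a l ih =>
    rw [List.pairwise_cons] at h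
    rw [List.insertionSort_cons, key, ih h.2, List.map_cons, List.prod_cons]
    exact fun y hy => h.1 y ((List.mem_insertionSort r).1 hy)

section
variable {k B ι κ : Type*} [Field k] [Ring B] [Algebra k B] {q : k} {Z : ι → κ → B}

theorem genMinor_succ_first {t : ℕ} (row : Fin (t + 1) → ι) (col : Fin (t + 1) → κ) :
    genMinor q Z row col = ∑ p : Fin (t + 1), (-q) ^ (p : ℕ) •
      (Z (row 0) (col p) * genMinor q Z (row ∘ Fin.succ) (col ∘ p.succAbove)) := by
  unfold genMinor
  rw [sum_perm_succ 0]
  refine Finset.sum_congr rfl fun p _ => ?_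
  rw [Finset.mul_sum, Finset.smul_sum]
  refine Finset.sum_congr rfl fun e _ => ?_
  simp [invCount_insertPerm_zero, List.ofFn_succ, pow_add, mul_smul]

theorem genMinor_succ_last {t : ℕ} (row : Fin (t + 1) → ι) (col : Fin (t + 1) → κ) :
    genMinor q Z row col = ∑ p : Fin (t + 1), (-q) ^ (t - (p : ℕ)) •
      (genMinor q Z (row ∘ Fin.castSucc) (col ∘ p.succAbove) * Z (row (Fin.last t)) (col p)) := by
  unfold genMinor
  rw [sum_perm_succ (Fin.last t)]
  refine Finset.sum_congr rfl fun p _ => ?_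
  rw [Finset.sum_mul, Finset.smul_sum]
  refine Finset.sum_congr rfl fun e _ => ?_
  rw [List.ofFn_succ']
  simp [invCount_insertPerm_last, pow_add, mul_smul]

end

section
variable {k B ι κ : Type*} [Field k] [Ring B] [Algebra k B] [LinearOrder ι] [LinearOrder κ]
  {q : k} {Z : ι → κ → B}

theorem genMinor_eq_zero_of_swap (hq : q ≠ 0) (hZ : IsQMat q Z) {t p : ℕ} (hp : p + 1 < t)
    (row : Fin t → ι) {col : Fin t → κ} (hcol : StrictMono col)
    (h : genMinor q Z (row ∘ Equiv.swap ⟨p, by omega⟩ ⟨p + 1, hp⟩) col = 0) :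
    genMinor q Z row col = 0 := by
  rcases lt_trichotomy (row ⟨p, by omega⟩) (row ⟨p + 1, hp⟩) with h' | h' | h'
  · rw [genMinor_swap hq hZ hp row hcol h'] at h
    exact (smul_eq_zero_iff_right (neg_ne_zero.2 hq)).1 h
  · exact genMinor_eq_zero_of_adjacent hZ hp row hcol h'
  · have := genMinor_swap hq hZ hp (row ∘ Equiv.swap ⟨p, by omega⟩ ⟨p + 1, hp⟩) hcol (by simpa)
    rw [h, smul_zero, Function.comp_assoc] at this
    simpa [← Equiv.Perm.coe_mul] using this

theorem genMinor_eq_zero_of_not_injective (hq : q ≠ 0) (hZ : IsQMat q Z) {t : ℕ}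
    {row : Fin t → ι} {col : Fin t → κ} (hcol : StrictMono col)
    (h : ¬ Function.Injective row) : genMinor q Z row col = 0 := by
  have key : ∀ (c a : ℕ) (hc : a + 1 + c < t) (row : Fin t → ι),
      row ⟨a, by omega⟩ = row ⟨a + 1 + c, hc⟩ → genMinor q Z row col = 0 := by
    intro c
    induction c with
    | zero => exact fun a hc row hrow => genMinor_eq_zero_of_adjacent hZ hc row hcol hrow
    | succ c ih =>
      intro a hc row hrow
      refine genMinor_eq_zero_of_swap hq hZ (p := a + 1 + c) hc row hcol
        (ih a (by omega) _ ?_)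
      rw [Function.comp_apply, Function.comp_apply, Equiv.swap_apply_left,
        Equiv.swap_apply_of_ne_of_ne (by simp [Fin.ext_iff]; omega)
          (by simp [Fin.ext_iff]; omega), hrow]
      rfl
  simp only [Function.Injective, not_forall] at h
  obtain ⟨a, b, hab, hne⟩ := h
  wlog hlt : a < b generalizing a b
  · exact this b a hab.symm (Ne.symm hne) (lt_of_le_of_ne (not_lt.1 hlt) (Ne.symm hne))
  have hlt' : (a : ℕ) < b := hlt
  refine key (b - a - 1) a (by omega) row ?_
  rw [show (⟨a, by omega⟩ : Fin t) = a from rfl, hab]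
  congr 1
  ext
  simp
  omega

theorem genMinor_comp_perm (hq : q ≠ 0) (hZ : IsQMat q Z) {t : ℕ} {row : Fin t → ι}
    (hrow : StrictMono row) {col : Fin t → κ} (hcol : StrictMono col) (τ : Equiv.Perm (Fin t)) :
    genMinor q Z (row ∘ τ) col = (-q) ^ invCount τ • genMinor q Z row col := by
  induction hn : invCount τ generalizing τ with
  | zero =>
    rw [Equiv.Perm.eq_one_of_no_descent τ]
    · simp
    · intro p hp
      by_contra hlt
      have hlt' : τ ⟨p + 1, hp⟩ < τ ⟨p, by omega⟩ :=
        lt_of_le_of_ne (not_lt.1 hlt) fun h => by simpa using τ.injective h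
      have := invCount_mul_swap hp (τ * Equiv.swap ⟨p, by omega⟩ ⟨p + 1, hp⟩) (by simpa)
      rw [mul_assoc, Equiv.swap_mul_self, mul_one] at this
      omega
  | succ n ih =>
    have hex : ∃ (p : ℕ) (hp : p + 1 < t), τ ⟨p + 1, hp⟩ < τ ⟨p, by omega⟩ := by
      by_contra hcon
      push Not at hcon
      rw [Equiv.Perm.eq_one_of_no_descent τ, invCount_one] at hn
      · omega
      · exact fun p hp => lt_of_le_of_ne (hcon p hp) fun h => by simpa using τ.injective h
    obtain ⟨p, hp, hlt⟩ := hex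
    have h1 := invCount_mul_swap hp (τ * Equiv.swap ⟨p, by omega⟩ ⟨p + 1, hp⟩) (by simpa)
    rw [mul_assoc, Equiv.swap_mul_self, mul_one] at h1
    have h2 := genMinor_swap hq hZ hp
      (row ∘ (τ * Equiv.swap ⟨p, Nat.lt_of_succ_lt hp⟩ ⟨p + 1, hp⟩ : Equiv.Perm (Fin t))) hcol
      (hrow (by simpa using hlt))
    rw [ih _ (by omega), Function.comp_assoc, ← Equiv.Perm.coe_mul, mul_assoc,
      Equiv.swap_mul_self, mul_one, smul_smul, ← pow_succ'] at h2
    exact h2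

theorem genMinor_transpose (hZ : IsQMat q Z) {t : ℕ} {row : Fin t → ι} (hrow : StrictMono row)
    {col : Fin t → κ} (hcol : StrictMono col) :
    genMinor q (fun j i => Z i j) col row = genMinor q Z row col := by
  unfold genMinor
  rw [← Equiv.sum_comp (Equiv.inv (Equiv.Perm (Fin t)))]
  refine Finset.sum_congr rfl fun σ _ => ?_
  simp only [Equiv.inv_apply, invCount_inv]
  congr 1
  have hs : (List.finRange t).insertionSort (fun a b => σ a ≤ σ b)
      = (List.finRange t).map (σ⁻¹ : Equiv.Perm (Fin t)) := by
    refine List.Perm.eq_of_pairwise (le := fun a b => σ a ≤ σ b)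
      (fun a b _ _ h1 h2 => σ.injective (le_antisymm h1 h2)) ?_ ?_ ?_
    · have : Std.Total (fun a b => σ a ≤ σ b) := ⟨fun a b => le_total _ _⟩
      have : IsTrans (Fin t) (fun a b => σ a ≤ σ b) := ⟨fun a b c => le_trans⟩
      exact List.pairwise_insertionSort _ _
    · rw [List.pairwise_map]
      exact (List.pairwise_lt_finRange t).imp fun h => by simpa using h.le
    · refine (List.perm_insertionSort _ _).trans ?_
      rw [List.perm_ext_iff_of_nodup (List.nodup_finRange t)
        ((List.nodup_finRange t).map (Equiv.injective _))]
      intro a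
      simp only [List.mem_finRange, List.mem_map, true_and, true_iff]
      exact ⟨σ a, by simp⟩
  have h := List.prod_map_insertionSort (fun a b => σ a ≤ σ b)
    (fun a => Z (row a) (col (σ a))) (List.finRange t)
    ((List.pairwise_lt_finRange t).imp @fun a b hab hn =>
      hZ.cross (row a) (row b) (col (σ a)) (col (σ b)) (hrow hab) (hcol (not_le.1 hn)))
  rw [hs, List.map_map] at h
  rw [List.ofFn_eq_map, List.ofFn_eq_map, ← h]
  congr 2
  funext a
  simp

end

section
variable {k B : Type*} [Field k] [Ring B] [Algebra k B] {q : k} {t : ℕ}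

/-- The quantum adjugate of a square family `Z`. -/
def qAdj (q : k) (Z : Fin (t + 1) → Fin (t + 1) → B) (l c : Fin (t + 1)) : B :=
  ((-q) ^ (l : ℕ) * ((-q) ^ (c : ℕ))⁻¹) • genMinor q Z c.succAbove l.succAbove

theorem sum_mul_qAdj (hq : q ≠ 0) {Z : Fin (t + 1) → Fin (t + 1) → B} (hZ : IsQMat q Z)
    (a c : Fin (t + 1)) :
    ∑ l, Z a l * qAdj q Z l c = if a = c then genMinor q Z id id else 0 := by
  have h : ∑ l, Z a l * qAdj q Z l c = ((-q) ^ (c : ℕ))⁻¹ •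
      genMinor q Z (Fin.cons a c.succAbove : Fin (t + 1) → Fin (t + 1)) id := by
    rw [genMinor_succ_first, Finset.smul_sum]
    refine Finset.sum_congr rfl fun l _ => ?_
    rw [qAdj, mul_smul_comm, smul_smul, mul_comm]
    rfl
  rw [h]
  split_ifs with hac
  · subst hac
    have : (Fin.cons a a.succAbove : Fin (t + 1) → Fin (t + 1)) = id ∘ insertPerm 0 a 1 := by
      funext i
      refine Fin.cases ?_ (fun i => ?_) i <;> simp
    rw [this, genMinor_comp_perm hq hZ strictMono_id strictMono_id, invCount_insertPerm_zero,
      invCount_one, add_zero, inv_smul_smul₀ (pow_ne_zero _ (neg_ne_zero.2 hq))]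
  · rw [genMinor_eq_zero_of_not_injective hq hZ strictMono_id, smul_zero]
    intro hinj
    obtain ⟨b, hb⟩ := Fin.exists_succAbove_eq hac
    exact Fin.succ_ne_zero b (hinj (by simpa using hb))

theorem sum_qAdj_mul (hq : q ≠ 0) {Z : Fin (t + 1) → Fin (t + 1) → B} (hZ : IsQMat q Z)
    (c a : Fin (t + 1)) :
    ∑ l, qAdj q Z c l * Z l a = if c = a then genMinor q Z id id else 0 := by
  have hq' : -q ≠ 0 := neg_ne_zero.2 hq
  have h : ∑ l, qAdj q Z c l * Z l a = ((-q) ^ (t - (c : ℕ)))⁻¹ •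
      genMinor q (fun j i => Z i j)
        (Fin.snoc (α := fun _ => Fin (t + 1)) c.succAbove a) id := by
    rw [genMinor_succ_last, Finset.smul_sum]
    refine Finset.sum_congr rfl fun l _ => ?_
    have h1 : (Fin.snoc (α := fun _ => Fin (t + 1)) c.succAbove a) ∘ Fin.castSucc
        = c.succAbove := by
      funext i
      simp
    rw [h1, Function.id_comp, genMinor_transpose hZ (Fin.strictMono_succAbove _)
      (Fin.strictMono_succAbove _), qAdj, smul_mul_assoc, smul_smul, Fin.snoc_last]
    congr 1
    have hc : (-q) ^ t = (-q) ^ (t - (c : ℕ)) * (-q) ^ (c : ℕ) := by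
      rw [← pow_add, Nat.sub_add_cancel (by omega)]
    have hl : (-q) ^ t = (-q) ^ (t - (l : ℕ)) * (-q) ^ (l : ℕ) := by
      rw [← pow_add, Nat.sub_add_cancel (by omega)]
    field_simp
    rw [mul_comm, ← hc, hl, mul_comm]
  rw [h]
  split_ifs with hac
  · subst hac
    have : Fin.snoc (α := fun _ => Fin (t + 1)) c.succAbove c
        = id ∘ insertPerm (Fin.last t) c 1 := by
      funext i
      refine Fin.lastCases ?_ (fun i => ?_) i <;> simp
    rw [this, genMinor_comp_perm hq hZ.transpose strictMono_id strictMono_id,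
      invCount_insertPerm_last, invCount_one, add_zero,
      inv_smul_smul₀ (pow_ne_zero _ hq'), genMinor_transpose hZ strictMono_id strictMono_id]
  · rw [genMinor_eq_zero_of_not_injective hq hZ.transpose strictMono_id, smul_zero]
    intro hinj
    obtain ⟨b, hb⟩ := Fin.exists_succAbove_eq (Ne.symm hac)
    exact Fin.castSucc_ne_last b (hinj (by simpa using hb))

theorem genMinor_id_commute (hq : q ≠ 0) {Z : Fin (t + 1) → Fin (t + 1) → B}
    (hZ : IsQMat q Z) (a c : Fin (t + 1)) :
    genMinor q Z id id * Z a c = Z a c * genMinor q Z id id := by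
  have h1 : (Matrix.of Z) * Matrix.of (qAdj q Z)
      = Matrix.diagonal fun _ => genMinor q Z id id := by
    ext a c
    simp [Matrix.mul_apply, sum_mul_qAdj hq hZ, Matrix.diagonal_apply]
  have h2 : Matrix.of (qAdj q Z) * Matrix.of Z
      = Matrix.diagonal fun _ => genMinor q Z id id := by
    ext a c
    simp [Matrix.mul_apply, sum_qAdj_mul hq hZ, Matrix.diagonal_apply]
  have h3 : Matrix.diagonal (fun _ => genMinor q Z id id) * Matrix.of Z
      = Matrix.of Z * Matrix.diagonal fun _ => genMinor q Z id id := by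
    rw [← h1, mul_assoc, h2, h1]
  simpa using congr_fun (congr_fun h3 a) c

end

section
variable {k B ι κ : Type*} [Field k] [Ring B] [Algebra k B] [LinearOrder ι] [LinearOrder κ]
  {q : k} {Z : ι → κ → B}

theorem genMinor_mul_of_lt (hZ : IsQMat q Z) {t : ℕ} {row : Fin t → ι} {col : Fin t → κ}
    {b : ι} {j : κ} (hb : ∀ a, b < row a) (hj : ∀ c, col c < j) :
    genMinor q Z row col * Z b j = Z b j * genMinor q Z row col := by
  induction t with
  | zero => simp [genMinor]
  | succ t ih =>
    rw [genMinor_succ_first, Finset.sum_mul, Finset.mul_sum]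
    refine Finset.sum_congr rfl fun p _ => ?_
    rw [smul_mul_assoc, mul_smul_comm, mul_assoc,
      ih (row := row ∘ Fin.succ) (col := col ∘ p.succAbove) (fun a => hb _) (fun c => hj _),
        ← mul_assoc,
      ← hZ.cross b (row 0) j (col p) (hb 0) (hj p), mul_assoc]

theorem genMinor_mul_of_eq (hq : q ≠ 0) (hZ : IsQMat q Z) {t : ℕ} {row : Fin t → ι}
    {col : Fin t → κ} (hrow : StrictMono row) (hcol : StrictMono col)
    (s : Fin t) {j : κ} (hj : ∀ c, col c < j) :
    genMinor q Z row col * Z (row s) j = q • (Z (row s) j * genMinor q Z row col) := by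
  induction t with
  | zero => exact s.elim0
  | succ t ih =>
    rw [genMinor_succ_first, Finset.sum_mul]
    refine Fin.cases ?_ (fun s => ?_) s
    · rw [Finset.mul_sum, Finset.smul_sum]
      refine Finset.sum_congr rfl fun p _ => ?_
      rw [smul_mul_assoc, mul_smul_comm, mul_assoc,
        genMinor_mul_of_lt hZ (row := row ∘ Fin.succ) (col := col ∘ p.succAbove)
          (fun a => hrow (Fin.succ_pos a)) (fun c => hj _), ← mul_assoc,
        hZ.row _ _ _ (hj p), smul_comm q, smul_mul_assoc, mul_assoc]
    · have h0 : ∑ p : Fin (t + 1), (-q) ^ (p : ℕ) • (Z (row s.succ) (col p) *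
          genMinor q Z (row ∘ Fin.succ) (col ∘ p.succAbove)) = 0 := by
        have := genMinor_succ_first (q := q) (Z := Z)
          (Fin.cons (row s.succ) (row ∘ Fin.succ) : Fin (t + 1) → ι) col
        rw [genMinor_eq_zero_of_not_injective hq hZ hcol] at this
        · exact this.symm
        · intro hinj
          exact Fin.succ_ne_zero s (hinj (by simp))
      have key : ∀ p : Fin (t + 1), (-q) ^ (p : ℕ) • (Z (row 0) (col p) *
          genMinor q Z (row ∘ Fin.succ) (col ∘ p.succAbove)) * Z (row s.succ) j
          = q • (Z (row s.succ) j * ((-q) ^ (p : ℕ) • (Z (row 0) (col p) *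
            genMinor q Z (row ∘ Fin.succ) (col ∘ p.succAbove)))) +
          (q * (q - q⁻¹)) • (Z (row 0) j * ((-q) ^ (p : ℕ) • (Z (row s.succ) (col p) *
            genMinor q Z (row ∘ Fin.succ) (col ∘ p.succAbove)))) := by
        intro p
        have := ih (row := row ∘ Fin.succ) (col := col ∘ p.succAbove)
          (hrow.comp (Fin.strictMono_succ)) (hcol.comp (Fin.strictMono_succAbove p)) s
          (fun c => hj _)
        rw [Function.comp_apply] at this
        rw [smul_mul_assoc, mul_assoc, this, mul_smul_comm, ← mul_assoc,
          hZ.diag _ _ _ _ (hrow (Fin.succ_pos s)) (hj p)]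
        simp only [add_mul, smul_mul_assoc, mul_smul_comm, mul_assoc]
        module
      rw [Finset.sum_congr rfl fun p _ => key p, Finset.sum_add_distrib, ← Finset.smul_sum,
        ← Finset.smul_sum, ← Finset.mul_sum, ← Finset.mul_sum, h0, mul_zero, smul_zero, add_zero]

theorem genMinor_mul_of_eq' (hq : q ≠ 0) (hZ : IsQMat q Z) {t : ℕ} {row : Fin t → ι}
    {col : Fin t → κ} (hrow : StrictMono row) (hcol : StrictMono col)
    (s : Fin t) {i : ι} (hi : ∀ c, row c < i) :
    genMinor q Z row col * Z i (col s) = q • (Z i (col s) * genMinor q Z row col) := by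
  rw [← genMinor_transpose hZ hrow hcol]
  exact genMinor_mul_of_eq hq hZ.transpose hcol hrow s hi

end

theorem pow_mul_eq_of_normal {A : Type*} [Monoid A] {d : A} {τ : A → A}
    (hd : ∀ a, d * a = τ a * d) (n : ℕ) (a : A) : d ^ n * a = τ^[n] a * d ^ n := by
  induction n with
  | zero => simp
  | succ n ih =>
    rw [pow_succ', mul_assoc, ih, ← mul_assoc, hd, mul_assoc, Function.iterate_succ_apply']

theorem mul_pow_eq_of_normal {A : Type*} [Monoid A] {d : A} {τ : A → A}
    (hd : ∀ a, a * d = d * τ a) (n : ℕ) (a : A) : a * d ^ n = d ^ n * τ^[n] a := by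
  induction n with
  | zero => simp
  | succ n ih =>
    rw [pow_succ, ← mul_assoc, ih, mul_assoc, hd, Function.iterate_succ_apply', ← mul_assoc]

/-- The localization of a ring at the powers of an element `d` that is normal with respect to a
pair of endomorphisms fixing `d`. -/
theorem exists_localization_of_normal {k A : Type} [Field k] [Ring A] [Algebra k A] {d : A}
    {τ : A →+* A} {τ' : A → A} (hτ : τ d = d) (hd : ∀ a, d * a = τ a * d)
    (hd' : ∀ a, a * d = d * τ' a) :
    ∃ (B : Type) (_ : Ring B) (_ : Algebra k B) (f : A →ₐ[k] B), IsUnit (f d) ∧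
      (∀ b, ∃ a n, b * f d ^ n = f a) ∧ (∀ b, ∃ a n, f d ^ n * b = f a) ∧
      ∀ a, f a = 0 → ∃ n, d ^ n * a = 0 := by
  have h1 := pow_mul_eq_of_normal hd
  have h2 := mul_pow_eq_of_normal hd'
  obtain ⟨_⟩ : Nonempty (OreLocalization.OreSet (Submonoid.powers d)) := by
    rw [OreLocalization.nonempty_oreSet_iff]
    constructor
    · rintro a b ⟨_, n, rfl⟩ hab
      refine ⟨⟨d ^ n, n, rfl⟩, sub_eq_zero.1 ?_⟩
      have : (a - b) * d ^ n = 0 := by rw [sub_mul, sub_eq_zero]; exact hab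
      have h := congrArg τ^[n] this
      rwa [iterate_map_mul, iterate_map_pow, Function.iterate_fixed hτ, iterate_map_zero, ← h1,
        mul_sub] at h
    · rintro a ⟨_, n, rfl⟩
      exact ⟨_, ⟨d ^ n, n, rfl⟩, h1 n a⟩
  let f : A →ₐ[k] OreLocalization (Submonoid.powers d) A :=
    { (OreLocalization.numeratorRingHom : A →+* OreLocalization (Submonoid.powers d) A) with
      commutes' := fun _ => rfl }
  have hf : ∀ a, f a = OreLocalization.numeratorHom a := fun _ => rfl
  have hu : IsUnit (f d) := OreLocalization.numerator_isUnit
    (⟨d, Submonoid.mem_powers d⟩ : Submonoid.powers d)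
  have hfrac : ∀ b, ∃ a n, f d ^ n * b = f a := by
    intro b
    induction b using OreLocalization.ind with
    | _ a s =>
      obtain ⟨_, n, rfl⟩ := s
      refine ⟨a, n, ?_⟩
      rw [← map_pow, hf, hf, OreLocalization.numeratorHom_apply]
      exact OreLocalization.mul_cancel (s := (⟨d ^ n, n, rfl⟩ : Submonoid.powers d))
  refine ⟨OreLocalization (Submonoid.powers d) A, inferInstance, inferInstance, f, hu, ?_, hfrac,
    ?_⟩
  · intro b
    obtain ⟨a, n, h⟩ := hfrac b
    refine ⟨τ'^[n] a, n, (hu.pow n).mul_left_cancel ?_⟩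
    rw [← mul_assoc, h, ← map_pow, ← map_mul, ← map_mul, h2]
  · intro a ha
    have : (a /ₒ (1 : Submonoid.powers d)) = 0 /ₒ 1 := by
      rw [OreLocalization.zero_oreDiv]
      exact ha
    rw [OreLocalization.oreDiv_eq_iff] at this
    obtain ⟨⟨_, n, rfl⟩, v, h3, h4⟩ := this
    refine ⟨n, ?_⟩
    have h4' : d ^ n = v := by simpa using h4
    rw [h4']
    simpa using h3.symm

theorem isQMat_Zgen (k : Type) [Field k] (q : k) (n r : ℕ) : IsQMat q (Zgen k q n r) where
  row i j l h := by
    simpa [Zgen] using RingQuot.mkAlgHom_rel k (QMatRel.row (k := k) (q := q) i j l h)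
  col i s j h := by
    simpa only [Zgen, map_mul, map_add, map_smul] using
      RingQuot.mkAlgHom_rel k (QMatRel.col (k := k) (q := q) i s j h)
  cross i s j l h1 h2 := by
    simpa only [Zgen, map_mul, map_add, map_smul] using
      RingQuot.mkAlgHom_rel k (QMatRel.cross (k := k) (q := q) i s j l h1 h2)
  diag i s j l h1 h2 := by
    simpa only [Zgen, map_mul, map_add, map_smul] using
      RingQuot.mkAlgHom_rel k (QMatRel.diag (k := k) (q := q) i s j l h1 h2)

theorem IsQMat.exists_algHom {k B : Type} [Field k] [Ring B] [Algebra k B] {q : k} {n r : ℕ}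
    {T : Fin n → Fin r → B} (hT : IsQMat q T) :
    ∃ f : QMat k q n r →ₐ[k] B, ∀ i j, f (Zgen k q n r i j) = T i j := by
  refine ⟨RingQuot.liftAlgHom k ⟨FreeAlgebra.lift k fun p => T p.1 p.2, ?_⟩, fun i j => by
    rw [Zgen, RingQuot.liftAlgHom_mkAlgHom_apply, FreeAlgebra.lift_ι_apply]⟩
  rintro _ _ (⟨i, j, l, h⟩ | ⟨i, s, j, h⟩ | ⟨i, s, j, l, h1, h2⟩ | ⟨i, s, j, l, h1, h2⟩)
  · simpa using hT.row i j l h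
  · simpa using hT.col i s j h
  · simpa using hT.cross i s j l h1 h2
  · simpa using hT.diag i s j l h1 h2

theorem IsQMat.smul {k B ι κ : Type*} [Field k] [Ring B] [Algebra k B] [LinearOrder ι]
    [LinearOrder κ] {q : k} {Z : ι → κ → B} (hZ : IsQMat q Z) (u : ι → k) (v : κ → k) :
    IsQMat q (fun i j => (u i * v j) • Z i j) where
  row i j l h := by
    simp only [smul_mul_assoc, mul_smul_comm, hZ.row i j l h]
    module
  col i s j h := by
    simp only [smul_mul_assoc, mul_smul_comm, hZ.col i s j h]
    module
  cross i s j l h1 h2 := by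
    simp only [smul_mul_assoc, mul_smul_comm, hZ.cross i s j l h1 h2]
    module
  diag i s j l h1 h2 := by
    simp only [smul_mul_assoc, mul_smul_comm, hZ.diag i s j l h1 h2]
    module

theorem map_genMinor {k B C ι κ : Type*} [Field k] [Ring B] [Algebra k B] [Ring C] [Algebra k C]
    (q : k) {t : ℕ} (f : B →ₐ[k] C) (Z : ι → κ → B) (row : Fin t → ι) (col : Fin t → κ) :
    f (genMinor q Z row col) = genMinor q (fun i j => f (Z i j)) row col := by
  simp [genMinor, map_sum, map_smul, map_list_prod, List.map_ofFn, Function.comp_def]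

section
variable {k : Type} [Field k] {q : k} {n r : ℕ}

theorem Zgen_mem_Asub {i j : Fin n} (h : (i : ℕ) < r ∨ (j : ℕ) < r) :
    Zgen k q n n i j ∈ Asub k q n r :=
  Algebra.subset_adjoin ⟨i, j, h, rfl⟩

theorem genMinor_mem_Asub {t : ℕ} {row col : Fin t → Fin n}
    (h : ∀ a b, (row a : ℕ) < r ∨ (col b : ℕ) < r) :
    genMinor q (Zgen k q n n) row col ∈ Asub k q n r := by
  refine Subalgebra.sum_mem _ fun σ _ => Subalgebra.smul_mem _ (Subalgebra.list_prod_mem _ ?_) _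
  simp only [List.mem_ofFn, forall_exists_index, forall_apply_eq_imp_iff]
  exact fun a => Zgen_mem_Asub (h _ _)

theorem dMinor_mem_Asub (h : r ≤ n) : dMinor k q n r h ∈ Asub k q n r :=
  genMinor_mem_Asub fun a _ => Or.inl a.2

/-- The factor by which `d` skew-commutes with a row or column. -/
def qWeight (r : ℕ) (lam : k) (i : Fin n) : k := if (i : ℕ) < r then 1 else lam

theorem dMinor_mul_Zgen (hq : q ≠ 0) (hr : 1 ≤ r) (h : r ≤ n) {i j : Fin n}
    (hij : (i : ℕ) < r ∨ (j : ℕ) < r) :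
    dMinor k q n r h * Zgen k q n n i j =
      (qWeight r q i * qWeight r q j) • Zgen k q n n i j * dMinor k q n r h := by
  obtain ⟨t, rfl⟩ : ∃ t, r = t + 1 := ⟨r - 1, by omega⟩
  have hZ := isQMat_Zgen k q n n
  have hm : StrictMono (Fin.castLE h) := Fin.strictMono_castLE h
  change genMinor q (Zgen k q n n) (Fin.castLE h) (Fin.castLE h) * _ =
    _ * genMinor q (Zgen k q n n) (Fin.castLE h) (Fin.castLE h)
  by_cases hi : (i : ℕ) < t + 1 <;> by_cases hj : (j : ℕ) < t + 1
  · rw [qWeight, if_pos hi, qWeight, if_pos hj, one_mul, one_smul]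
    exact genMinor_id_commute hq (hZ.submatrix hm hm) ⟨i, hi⟩ ⟨j, hj⟩
  · rw [qWeight, if_pos hi, qWeight, if_neg hj, one_mul, smul_mul_assoc]
    exact genMinor_mul_of_eq hq hZ hm hm ⟨i, hi⟩ fun c => Fin.lt_def.2 (by simp; omega)
  · rw [qWeight, if_neg hi, qWeight, if_pos hj, mul_one, smul_mul_assoc]
    exact genMinor_mul_of_eq' hq hZ hm hm ⟨j, hj⟩ fun c => Fin.lt_def.2 (by simp; omega)
  · omega

theorem exists_Asub_twist (lam : k) (h : r ≤ n) :
    ∃ τ : Asub k q n r →ₐ[k] Asub k q n r,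
      (∀ (i j : Fin n) (hij : (i : ℕ) < r ∨ (j : ℕ) < r),
        τ ⟨Zgen k q n n i j, Zgen_mem_Asub hij⟩ =
          (qWeight r lam i * qWeight r lam j) • ⟨Zgen k q n n i j, Zgen_mem_Asub hij⟩) ∧
      τ ⟨dMinor k q n r h, dMinor_mem_Asub h⟩ = ⟨dMinor k q n r h, dMinor_mem_Asub h⟩ := by
  obtain ⟨f, hf⟩ :=
    ((isQMat_Zgen k q n n).smul (qWeight r lam) (qWeight r lam)).exists_algHom
  have hmem : ∀ x : Asub k q n r, f x ∈ Asub k q n r := by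
    rintro ⟨x, hx⟩
    refine Algebra.adjoin_induction (p := fun x _ => f x ∈ Asub k q n r) ?_ ?_ ?_ ?_ hx
    · rintro _ ⟨i, j, hij, rfl⟩
      rw [hf]
      exact Subalgebra.smul_mem _ (Zgen_mem_Asub hij) _
    · intro c
      rw [AlgHom.commutes]
      exact Subalgebra.algebraMap_mem _ c
    · intro x y _ _ hx hy
      rw [map_add]
      exact Subalgebra.add_mem _ hx hy
    · intro x y _ _ hx hy
      rw [map_mul]
      exact Subalgebra.mul_mem _ hx hy
  refine ⟨(f.comp (Asub k q n r).val).codRestrict (Asub k q n r) hmem,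
    fun i j hij => Subtype.ext (hf i j), Subtype.ext ?_⟩
  change f (genMinor q (Zgen k q n n) (Fin.castLE h) (Fin.castLE h)) =
    genMinor q (Zgen k q n n) (Fin.castLE h) (Fin.castLE h)
  rw [map_genMinor]
  unfold genMinor
  refine Finset.sum_congr rfl fun σ _ => ?_
  congr 3
  funext a
  simp [hf, qWeight]

theorem Asub_hom_rel {C : Type*} [Semiring C] [Algebra k C] {f g : Asub k q n r →ₐ[k] C} {c : C}
    (h : ∀ (i j : Fin n) (hij : (i : ℕ) < r ∨ (j : ℕ) < r),
      c * f ⟨Zgen k q n n i j, Zgen_mem_Asub hij⟩ = g ⟨Zgen k q n n i j, Zgen_mem_Asub hij⟩ * c)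
    (a : Asub k q n r) : c * f a = g a * c := by
  obtain ⟨x, hx⟩ := a
  induction hx using Algebra.adjoin_induction with
  | mem x hx =>
    obtain ⟨i, j, hij, rfl⟩ := hx
    exact h i j hij
  | algebraMap a =>
    have h1 := f.commutes a
    have h2 := g.commutes a
    exact (congrArg (c * ·) h1).trans ((Algebra.commutes a c).symm.trans (congrArg (· * c) h2.symm))
  | add x y hx hy h1 h2 =>
    have : (⟨x + y, Subalgebra.add_mem _ hx hy⟩ : Asub k q n r) = ⟨x, hx⟩ + ⟨y, hy⟩ := rfl
    rw [this, map_add, map_add, mul_add, h1, h2, add_mul]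
  | mul x y hx hy h1 h2 =>
    have : (⟨x * y, Subalgebra.mul_mem _ hx hy⟩ : Asub k q n r) = ⟨x, hx⟩ * ⟨y, hy⟩ := rfl
    rw [this, map_mul, map_mul, ← mul_assoc, h1, mul_assoc, h2, mul_assoc]

theorem exists_dMinor_twist (hq : q ≠ 0) (hr : 1 ≤ r) (h : r ≤ n) :
    ∃ τ τ' : Asub k q n r →ₐ[k] Asub k q n r,
      τ ⟨dMinor k q n r h, dMinor_mem_Asub h⟩ = ⟨dMinor k q n r h, dMinor_mem_Asub h⟩ ∧
      (∀ a, ⟨dMinor k q n r h, dMinor_mem_Asub h⟩ * a =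
        τ a * ⟨dMinor k q n r h, dMinor_mem_Asub h⟩) ∧
      ∀ a, a * ⟨dMinor k q n r h, dMinor_mem_Asub h⟩ =
        ⟨dMinor k q n r h, dMinor_mem_Asub h⟩ * τ' a := by
  obtain ⟨τ, h1, h2⟩ := exists_Asub_twist (q := q) q h
  obtain ⟨τ', h1', -⟩ := exists_Asub_twist (q := q) q⁻¹ h
  refine ⟨τ, τ', h2, Asub_hom_rel (f := AlgHom.id k _) fun i j hij => ?_, fun a =>
    (Asub_hom_rel (g := AlgHom.id k _) (fun i j hij => ?_) a).symm⟩
  · rw [h1 i j hij]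
    exact Subtype.ext (dMinor_mul_Zgen hq hr h hij)
  · rw [h1' i j hij]
    refine Subtype.ext ?_
    change dMinor k q n r h * ((qWeight r q⁻¹ i * qWeight r q⁻¹ j) • Zgen k q n n i j) =
      Zgen k q n n i j * dMinor k q n r h
    rw [mul_smul_comm, dMinor_mul_Zgen hq hr h hij, smul_mul_assoc, smul_smul]
    have hw : ∀ i : Fin n, qWeight r q⁻¹ i * qWeight r q i = 1 := by
      intro i
      unfold qWeight
      split_ifs <;> simp [hq]
    rw [mul_mul_mul_comm, hw, hw, one_mul, one_smul]

end

section
variable {k B : Type*} [Field k] [Ring B] [Algebra k B]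

/-- The R-matrix form of the relations of a quantized matrix algebra at four entries. -/
def RTTRel (q : k) (z : ℕ → ℕ → B) (i s j l : ℕ) : Prop :=
  (if i = s then q else 1) • (z i j * z s l) + (if s < i then (q - q⁻¹) • (z s j * z i l) else 0) =
    (if j = l then q else 1) • (z s l * z i j) +
      if j < l then (q - q⁻¹) • (z s j * z i l) else 0

theorem IsQMat.rttRel {q : k} (hq : q ≠ 0) {n : ℕ} {Z : Fin n → Fin n → B} (hZ : IsQMat q Z)
    {z : ℕ → ℕ → B} (hz : ∀ i j : Fin n, z i j = Z i j) (i s j l : Fin n) :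
    RTTRel q z i s j l := by
  simp only [RTTRel, hz, Fin.val_inj, Fin.val_fin_lt]
  rcases lt_trichotomy i s with h | rfl | h <;> rcases lt_trichotomy j l with h' | rfl | h'
  · simp only [h.ne, h'.ne, h.not_gt, h', if_true, if_false, one_smul, add_zero]
    rw [hZ.diag _ _ _ _ h h', hZ.cross _ _ _ _ h h']
  · simp only [h.ne, h.not_gt, lt_irrefl, if_true, if_false, one_smul, add_zero]
    exact hZ.col _ _ _ h
  · simp only [h.ne, h'.ne', h.not_gt, h'.not_gt, if_false, one_smul, add_zero]
    exact hZ.cross _ _ _ _ h h'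
  · simp only [h', h'.ne, lt_irrefl, if_true, if_false, one_smul, add_zero]
    rw [hZ.row _ _ _ h', smul_smul, smul_smul, sub_mul, inv_mul_cancel₀ hq]
    module
  · simp
  · simp only [h'.ne', h'.not_gt, lt_irrefl, if_true, if_false, one_smul, add_zero]
    exact (hZ.row _ _ _ h').symm
  · simp only [h.ne', h'.ne, h, h', if_true, if_false, one_smul]
    rw [hZ.cross _ _ _ _ h h']
  · simp only [h.ne', h, lt_irrefl, if_true, if_false, one_smul, add_zero]
    rw [hZ.col _ _ _ h, smul_smul, smul_smul, sub_mul, inv_mul_cancel₀ hq]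
    module
  · simp only [h.ne', h'.ne', h, h'.not_gt, if_true, if_false, one_smul, add_zero]
    exact (hZ.diag _ _ _ _ h h').symm

theorem isQMat_of_rttRel {q : k} (hq : q ≠ 0) {n : ℕ} {z : ℕ → ℕ → B}
    (hz : ∀ i s j l : Fin n, RTTRel q z i s j l) : IsQMat q fun i j : Fin n => z i j := by
  have hcross : ∀ i s j l : Fin n, i < s → l < j → z i j * z s l = z s l * z i j := by
    intro i s j l h h'
    have := hz i s j l
    simpa only [RTTRel, Fin.val_inj, Fin.val_fin_lt, h.ne, h'.ne', h.not_gt, h'.not_gt, if_false,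
      one_smul, add_zero] using this
  refine ⟨fun i j l h' => ?_, fun i s j h => ?_, hcross, fun i s j l h hl => ?_⟩
  · have := hz i i j l
    simp only [RTTRel, Fin.val_inj, Fin.val_fin_lt, h', h'.ne, lt_irrefl, if_true, if_false,
      one_smul, add_zero] at this
    rw [sub_smul, add_sub, add_comm, ← add_sub, left_eq_add, sub_eq_zero] at this
    rw [this, smul_inv_smul₀ hq]
  · have := hz i s j j
    simpa only [RTTRel, Fin.val_inj, Fin.val_fin_lt, h.ne, h.not_gt, lt_irrefl, if_true, if_false,
      one_smul, add_zero] using this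
  · have := hz i s j l
    simp only [RTTRel, Fin.val_inj, Fin.val_fin_lt, h.ne, hl.ne, h.not_gt, hl, if_true, if_false,
      one_smul, add_zero] at this
    rw [this, hcross i s l j h hl]

/-- The R-matrix acting on `k^a ⊗ k^b`. -/
def qR (B : Type*) [Ring B] [Algebra k B] (q : k) (a b : ℕ) :
    Matrix (Fin a × Fin b) (Fin a × Fin b) B := fun x y =>
  (if y = x then algebraMap k B (if (x.1 : ℕ) = x.2 then q else 1) else 0) +
    if (x.2 : ℕ) < x.1 ∧ (y.1 : ℕ) = x.2 ∧ (y.2 : ℕ) = x.1 then algebraMap k B (q - q⁻¹) else 0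

/-- `U ⊗ 1`. -/
def legOne {m p : Type*} (o : Type*) [DecidableEq o] (U : Matrix m p B) :
    Matrix (m × o) (p × o) B :=
  Matrix.blockDiagonal fun _ => U

/-- `1 ⊗ U`. -/
def legTwo {m p : Type*} (o : Type*) [DecidableEq o] (U : Matrix m p B) :
    Matrix (o × m) (o × p) B :=
  (Matrix.blockDiagonal fun _ : o => U).submatrix Prod.swap Prod.swap

theorem legOne_mul {m p p' o : Type*} [Fintype p] [Fintype o] [DecidableEq o]
    (U : Matrix m p B) (V : Matrix p p' B) : legOne o (U * V) = legOne o U * legOne o V :=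
  Matrix.blockDiagonal_mul (fun _ => U) fun _ => V

theorem legTwo_mul {m p p' o : Type*} [Fintype p] [Fintype o] [DecidableEq o]
    (U : Matrix m p B) (V : Matrix p p' B) : legTwo o (U * V) = legTwo o U * legTwo o V := by
  unfold legTwo
  rw [Matrix.blockDiagonal_mul (fun _ => U) fun _ => V]
  exact (Matrix.submatrix_mul_equiv _ _ _ (Equiv.prodComm o p) _).symm

theorem legOne_one {m o : Type*} [DecidableEq m] [DecidableEq o] :
    legOne o (1 : Matrix m m B) = 1 :=
  Matrix.blockDiagonal_one

theorem legTwo_one {m o : Type*} [DecidableEq m] [DecidableEq o] :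
    legTwo o (1 : Matrix m m B) = 1 := by
  unfold legTwo
  rw [show (fun _ : o => (1 : Matrix m m B)) = 1 from rfl, Matrix.blockDiagonal_one]
  exact Matrix.submatrix_one_equiv (Equiv.prodComm o m)

theorem legOne_mul_legTwo_apply {m p m' p' : Type*} [Fintype p] [Fintype m'] [DecidableEq p]
    [DecidableEq m'] (U : Matrix m p B) (V : Matrix m' p' B) (x : m × m') (y : p × p') :
    (legOne m' U * legTwo p V) x y = U x.1 y.1 * V x.2 y.2 := by
  simp [Matrix.mul_apply, legOne, legTwo, Matrix.blockDiagonal_apply, Fintype.sum_prod_type]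

theorem legTwo_mul_legOne_apply {m p m' p' : Type*} [Fintype m] [Fintype p'] [DecidableEq m]
    [DecidableEq p'] (U : Matrix m p B) (V : Matrix m' p' B) (x : m × m') (y : p × p') :
    (legTwo m V * legOne p' U) x y = V x.2 y.2 * U x.1 y.1 := by
  simp [Matrix.mul_apply, legOne, legTwo, Matrix.blockDiagonal_apply, Fintype.sum_prod_type_right]

theorem qR_mul_apply {γ : Type*} (q : k) {a b : ℕ} (hab : a ≤ b)
    (M : Matrix (Fin a × Fin b) γ B) (i : Fin a) (s : Fin b) (y : γ) :
    (qR B q a b * M) (i, s) y = (if (i : ℕ) = s then q else 1) • M (i, s) y +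
      if h : (s : ℕ) < i then
        (q - q⁻¹) • M (⟨s, h.trans i.2⟩, ⟨i, i.2.trans_le hab⟩) y else 0 := by
  simp only [Matrix.mul_apply, qR, add_mul, Finset.sum_add_distrib, ite_mul, zero_mul,
    Finset.sum_ite_eq', Finset.mem_univ, if_true, ← Algebra.smul_def]
  congr 1
  split_ifs with h
  · rw [Finset.sum_eq_single (⟨s, h.trans i.2⟩, ⟨i, i.2.trans_le hab⟩)]
    · simp [h]
    · rintro ⟨c, d⟩ _ hne
      rw [if_neg]
      rintro ⟨-, h1, h2⟩
      exact hne (Prod.ext (Fin.ext h1) (Fin.ext h2))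
    · simp
  · simp [h]

theorem mul_qR_apply {γ : Type*} (q : k) {c d : ℕ} (hdc : d ≤ c)
    (M : Matrix γ (Fin c × Fin d) B) (x : γ) (j : Fin c) (l : Fin d) :
    (M * qR B q c d) x (j, l) = (if (j : ℕ) = l then q else 1) • M x (j, l) +
      if h : (j : ℕ) < l then
        (q - q⁻¹) • M x (⟨l, l.2.trans_le hdc⟩, ⟨j, h.trans l.2⟩) else 0 := by
  simp only [Matrix.mul_apply, qR, mul_add, Finset.sum_add_distrib, mul_ite, mul_zero,
    Finset.sum_ite_eq, Finset.mem_univ, if_true, ← Algebra.commutes, ← Algebra.smul_def]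
  congr 1
  split_ifs with h
  · rw [Finset.sum_eq_single (⟨l, l.2.trans_le hdc⟩, ⟨j, h.trans l.2⟩)]
    · simp [h]
    · rintro ⟨u, v⟩ _ hne
      rw [if_neg]
      rintro ⟨-, h1, h2⟩
      exact hne (Prod.ext (Fin.ext h2.symm) (Fin.ext h1.symm))
    · simp
  · refine Finset.sum_eq_zero fun u _ => if_neg ?_
    omega

theorem qR_mul_left_cancel {γ : Type*} {q : k} (hq : q ≠ 0) {a b : ℕ} (hab : a ≤ b)
    {M N : Matrix (Fin a × Fin b) γ B} (h : qR B q a b * M = qR B q a b * N) : M = N := by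
  have h1 : ∀ (i : Fin a) (s : Fin b) y, (i : ℕ) ≤ s → M (i, s) y = N (i, s) y := by
    intro i s y his
    have := congr_fun (congr_fun h (i, s)) y
    rw [qR_mul_apply q hab, qR_mul_apply q hab, dif_neg his.not_gt, dif_neg his.not_gt, add_zero,
      add_zero] at this
    split_ifs at this
    · simpa [hq] using this
    · simpa using this
  ext ⟨i, s⟩ y
  by_cases his : (i : ℕ) ≤ s
  · exact h1 i s y his
  · have := congr_fun (congr_fun h (i, s)) y
    rw [qR_mul_apply q hab, qR_mul_apply q hab, dif_pos (not_le.1 his), dif_pos (not_le.1 his),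
      h1 ⟨s, _⟩ ⟨i, _⟩ y (not_le.1 his).le, if_neg (by omega)] at this
    simpa using this

theorem qR_legs (q : k) {a b c d : ℕ} (hab : a ≤ b) (hdc : d ≤ c) {z : ℕ → ℕ → B}
    {U : Matrix (Fin a) (Fin c) B} {V : Matrix (Fin b) (Fin d) B} (hU : ∀ i j, U i j = z i j)
    (hV : ∀ i j, V i j = z i j)
    (hz : ∀ (i : Fin a) (s : Fin b) (j : Fin c) (l : Fin d), RTTRel q z i s j l) :
    qR B q a b * (legOne (Fin b) U * legTwo (Fin c) V) =
      legTwo (Fin a) V * legOne (Fin d) U * qR B q c d := by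
  ext ⟨i, s⟩ ⟨j, l⟩
  rw [qR_mul_apply q hab, mul_qR_apply q hdc]
  simp only [legOne_mul_legTwo_apply, legTwo_mul_legOne_apply, hU, hV, dite_eq_ite]
  exact hz i s j l

theorem rttRel_of_qR_legs {q : k} {n : ℕ} {z : ℕ → ℕ → B} {U : Matrix (Fin n) (Fin n) B}
    (hU : ∀ i j, U i j = z i j)
    (h : qR B q n n * (legOne (Fin n) U * legTwo (Fin n) U) =
      legTwo (Fin n) U * legOne (Fin n) U * qR B q n n)
    (i s j l : Fin n) : RTTRel q z i s j l := by
  have := congr_fun (congr_fun h (i, s)) (j, l)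
  rw [qR_mul_apply q le_rfl, mul_qR_apply q le_rfl] at this
  simp only [legOne_mul_legTwo_apply, legTwo_mul_legOne_apply, hU, dite_eq_ite] at this
  exact this

theorem rttRel_mul_inv_mul {q : k} (hq : q ≠ 0) {n r : ℕ} (hrn : r ≤ n) {z : ℕ → ℕ → B}
    (hz : ∀ i s j l, i < n → s < n → j < n → l < n →
      (i < r ∧ s < r ∨ j < r ∧ l < r ∨ i < r ∧ l < r) → RTTRel q z i s j l)
    {X Y : Matrix (Fin r) (Fin r) B} {P : Matrix (Fin n) (Fin r) B} {Q : Matrix (Fin r) (Fin n) B}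
    (hX : ∀ i j, X i j = z i j) (hP : ∀ i j, P i j = z i j) (hQ : ∀ i j, Q i j = z i j)
    (hXY : X * Y = 1) (hYX : Y * X = 1) {T : ℕ → ℕ → B}
    (hT : ∀ i j : Fin n, T i j = (P * Y * Q) i j) (i s j l : Fin n) : RTTRel q T i s j l := by
  have hPP := qR_legs q (le_refl n) (le_refl r) hP hP fun i s j l =>
    hz i s j l i.2 s.2 (by omega) (by omega) (Or.inr (Or.inl ⟨j.2, l.2⟩))
  have hQQ := qR_legs q (le_refl r) (le_refl n) hQ hQ fun i s j l =>
    hz i s j l (by omega) (by omega) j.2 l.2 (Or.inl ⟨i.2, s.2⟩)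
  have hXX := qR_legs q (le_refl r) (le_refl r) hX hX fun i s j l =>
    hz i s j l (by omega) (by omega) (by omega) (by omega) (Or.inl ⟨i.2, s.2⟩)
  have hXP := qR_legs q hrn (le_refl r) hX hP fun i s j l =>
    hz i s j l (by omega) s.2 (by omega) (by omega) (Or.inr (Or.inl ⟨j.2, l.2⟩))
  have hQX := qR_legs q (le_refl r) hrn hQ hX fun i s j l =>
    hz i s j l (by omega) (by omega) j.2 (by omega) (Or.inl ⟨i.2, s.2⟩)
  have hQP := qR_legs q hrn hrn hQ hP fun i s j l =>
    hz i s j l (by omega) s.2 j.2 (by omega) (Or.inr (Or.inr ⟨i.2, l.2⟩))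
  have h1 : ∀ m : ℕ, legOne (Fin m) X * legOne (Fin m) Y = 1 := fun m => by
    rw [← legOne_mul, hXY, legOne_one]
  have h1' : ∀ m : ℕ, legOne (Fin m) Y * legOne (Fin m) X = 1 := fun m => by
    rw [← legOne_mul, hYX, legOne_one]
  have h2 : ∀ m : ℕ, legTwo (Fin m) X * legTwo (Fin m) Y = 1 := fun m => by
    rw [← legTwo_mul, hXY, legTwo_one]
  have h2' : ∀ m : ℕ, legTwo (Fin m) Y * legTwo (Fin m) X = 1 := fun m => by
    rw [← legTwo_mul, hYX, legTwo_one]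
  have hYY : qR B q r r * (legTwo (Fin r) Y * legOne (Fin r) Y) =
      legOne (Fin r) Y * legTwo (Fin r) Y * qR B q r r := by
    calc qR B q r r * (legTwo (Fin r) Y * legOne (Fin r) Y)
        = legOne (Fin r) Y * (legTwo (Fin r) Y * legTwo (Fin r) X) * legOne (Fin r) X *
            qR B q r r * (legTwo (Fin r) Y * legOne (Fin r) Y) := by
          rw [h2', mul_one, h1', one_mul]
      _ = legOne (Fin r) Y * legTwo (Fin r) Y *
            (legTwo (Fin r) X * legOne (Fin r) X * qR B q r r) *
            (legTwo (Fin r) Y * legOne (Fin r) Y) := by simp only [mul_assoc]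
      _ = legOne (Fin r) Y * legTwo (Fin r) Y * qR B q r r *
            (legOne (Fin r) X * (legTwo (Fin r) X * legTwo (Fin r) Y) * legOne (Fin r) Y) := by
          rw [← hXX]; simp only [mul_assoc]
      _ = _ := by rw [h2, mul_one, h1, mul_one]
  have hQP' : legOne (Fin n) Q * legTwo (Fin n) P =
      legOne (Fin n) X * legTwo (Fin r) P * (legTwo (Fin r) Y * legOne (Fin r) Y) *
        (legOne (Fin r) Q * legTwo (Fin n) X) := by
    refine qR_mul_left_cancel hq hrn ?_
    symm
    calc qR B q r n * (legOne (Fin n) X * legTwo (Fin r) P * (legTwo (Fin r) Y * legOne (Fin r) Y) *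
          (legOne (Fin r) Q * legTwo (Fin n) X))
        = qR B q r n * (legOne (Fin n) X * legTwo (Fin r) P) *
            (legTwo (Fin r) Y * legOne (Fin r) Y) * (legOne (Fin r) Q * legTwo (Fin n) X) := by
          simp only [Matrix.mul_assoc]
      _ = legTwo (Fin r) P * legOne (Fin r) X *
            (qR B q r r * (legTwo (Fin r) Y * legOne (Fin r) Y)) *
            (legOne (Fin r) Q * legTwo (Fin n) X) := by rw [hXP]; simp only [Matrix.mul_assoc]
      _ = legTwo (Fin r) P * (legOne (Fin r) X * legOne (Fin r) Y) * legTwo (Fin r) Y *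
            (qR B q r r * (legOne (Fin r) Q * legTwo (Fin n) X)) := by
          rw [hYY]; simp only [Matrix.mul_assoc]
      _ = legTwo (Fin r) P * (legTwo (Fin r) Y * legTwo (Fin r) X) * legOne (Fin r) Q *
            qR B q n r := by
          rw [h1, hQX, Matrix.mul_one]; simp only [Matrix.mul_assoc]
      _ = _ := by rw [h2', Matrix.mul_one, ← hQP]
  have huw : legOne (Fin n) (Y * Q) * legTwo (Fin n) (P * Y) =
      legTwo (Fin r) (P * Y) * legOne (Fin r) (Y * Q) := by
    calc legOne (Fin n) (Y * Q) * legTwo (Fin n) (P * Y)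
        = legOne (Fin n) Y * (legOne (Fin n) Q * legTwo (Fin n) P) * legTwo (Fin n) Y := by
          rw [legOne_mul, legTwo_mul]; simp only [Matrix.mul_assoc]
      _ = (legOne (Fin n) Y * legOne (Fin n) X) * (legTwo (Fin r) P *
            (legTwo (Fin r) Y * (legOne (Fin r) Y * (legOne (Fin r) Q *
              (legTwo (Fin n) X * legTwo (Fin n) Y))))) := by
          rw [hQP']; simp only [Matrix.mul_assoc]
      _ = _ := by
          rw [h1', h2, Matrix.one_mul, Matrix.mul_one, legOne_mul, legTwo_mul]
          simp only [Matrix.mul_assoc]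
  have huw' : legTwo (Fin n) (Y * Q) * legOne (Fin n) (P * Y) =
      legOne (Fin r) (P * Y) * legTwo (Fin r) (Y * Q) := by
    ext x y
    have := congr_fun (congr_fun huw (x.2, x.1)) (y.2, y.1)
    rw [legOne_mul_legTwo_apply, legTwo_mul_legOne_apply] at this
    rw [legOne_mul_legTwo_apply, legTwo_mul_legOne_apply]
    exact this
  refine rttRel_of_qR_legs (U := P * Y * Q) (fun i j => (hT i j).symm) ?_ i s j l
  calc qR B q n n * (legOne (Fin n) (P * Y * Q) * legTwo (Fin n) (P * Y * Q))
      = qR B q n n * (legOne (Fin n) P * (legOne (Fin n) (Y * Q) * legTwo (Fin n) (P * Y)) *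
          legTwo (Fin n) Q) := by
        rw [Matrix.mul_assoc P Y Q, legOne_mul P (Y * Q), ← Matrix.mul_assoc P Y Q,
          legTwo_mul (P * Y) Q]
        simp only [Matrix.mul_assoc]
    _ = qR B q n n * (legOne (Fin n) P * legTwo (Fin r) P) *
          (legTwo (Fin r) Y * legOne (Fin r) Y) * (legOne (Fin r) Q * legTwo (Fin n) Q) := by
        rw [huw, legOne_mul, legTwo_mul]; simp only [Matrix.mul_assoc]
    _ = legTwo (Fin n) P * legOne (Fin r) P * (qR B q r r *
          (legTwo (Fin r) Y * legOne (Fin r) Y)) * (legOne (Fin r) Q * legTwo (Fin n) Q) := by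
        rw [hPP]; simp only [Matrix.mul_assoc]
    _ = legTwo (Fin n) P * legOne (Fin r) P * (legOne (Fin r) Y * legTwo (Fin r) Y) *
          (qR B q r r * (legOne (Fin r) Q * legTwo (Fin n) Q)) := by
        rw [hYY]; simp only [Matrix.mul_assoc]
    _ = legTwo (Fin n) P * (legOne (Fin r) (P * Y) * legTwo (Fin r) (Y * Q)) *
          legOne (Fin n) Q * qR B q n n := by
        rw [hQQ, legOne_mul, legTwo_mul]; simp only [Matrix.mul_assoc]
    _ = _ := by
        rw [← huw', Matrix.mul_assoc P Y Q, legTwo_mul P (Y * Q), ← Matrix.mul_assoc P Y Q,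
          legOne_mul (P * Y) Q]
        simp only [Matrix.mul_assoc]

end

section
variable {k B : Type*} [Field k] [Ring B] [Algebra k B] {q : k} {n r : ℕ}

/-- If every row of `T` is a left linear combination of the first `r` rows, then the quantum minors
of size `r + 1` vanish. -/
theorem genMinor_eq_zero_of_row_combination (hq : q ≠ 0) (hrn : r ≤ n) {T : Fin n → Fin n → B}
    (hT : IsQMat q T) (w : Fin n → Fin r → B)
    (hw : ∀ i j, T i j = ∑ c, w i c * T (Fin.castLE hrn c) j) (row : Fin (r + 1) → Fin n)
    {col : Fin (r + 1) → Fin n} (hcol : StrictMono col) : genMinor q T row col = 0 := by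
  induction hN : ∑ a, (if r ≤ (row a : ℕ) then 1 else 0) generalizing row with
  | zero =>
    refine genMinor_eq_zero_of_not_injective hq hT hcol fun hinj => ?_
    have hlt : ∀ a, (row a : ℕ) < r := by simpa using hN
    have := Fintype.card_le_of_injective (fun a => (⟨row a, hlt a⟩ : Fin r)) fun a b hab =>
      hinj (Fin.ext (Fin.mk.inj_iff.1 hab))
    simp at this
  | succ N ih =>
    have key : ∀ (p : ℕ) (hp : p < r + 1) (row : Fin (r + 1) → Fin n), r ≤ (row ⟨p, hp⟩ : ℕ) →
        ∑ a, (if r ≤ (row a : ℕ) then 1 else 0) = N + 1 → genMinor q T row col = 0 := by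
      intro p
      induction p with
      | zero =>
        intro _ row hrow hN
        have hrow' : r ≤ (row 0 : ℕ) := hrow
        have hsum : genMinor q T row col = ∑ c, w (row 0) c *
            genMinor q T (Fin.cons (Fin.castLE hrn c) (row ∘ Fin.succ) : Fin (r + 1) → Fin n)
              col := by
          simp only [genMinor_succ_first]
          simp only [hw (row 0), Finset.sum_mul, Finset.mul_sum, Finset.smul_sum]
          rw [Finset.sum_comm]
          refine Finset.sum_congr rfl fun c _ => Finset.sum_congr rfl fun p _ => ?_
          rw [mul_smul_comm, mul_assoc]
          rfl
        rw [hsum]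
        refine Finset.sum_eq_zero fun c _ => ?_
        rw [ih, mul_zero]
        rw [Fin.sum_univ_succ, if_pos hrow'] at hN
        rw [Fin.sum_univ_succ]
        simp only [Fin.cons_zero, Fin.val_castLE, Fin.cons_succ, Function.comp_apply]
        rw [if_neg (by omega)]
        omega
      | succ p ihp =>
        intro hp row hrow hN
        refine genMinor_eq_zero_of_swap hq hT hp row hcol (ihp (by omega) _ ?_ ?_)
        · simpa using hrow
        · rw [← hN]
          exact Equiv.sum_comp (Equiv.swap _ _) fun a => if r ≤ (row a : ℕ) then 1 else 0
    obtain ⟨p, hp⟩ : ∃ p, r ≤ (row p : ℕ) := by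
      by_contra! hcon
      rw [Finset.sum_eq_zero fun a _ => if_neg (not_le.2 (hcon a))] at hN
      omega
    exact key p p.2 row hp hN

theorem RTTRel.congr {z z' : ℕ → ℕ → B} {i s j l : ℕ} (h1 : z i j = z' i j) (h2 : z s l = z' s l)
    (h3 : s < i ∨ j < l → z s j = z' s j ∧ z i l = z' i l) (h : RTTRel q z i s j l) :
    RTTRel q z' i s j l := by
  unfold RTTRel at *
  rw [← h1, ← h2]
  by_cases hs : s < i <;> by_cases hj : j < l <;> simp only [hs, hj, true_or, or_true,
    forall_true_left, if_true, if_false] at h h3 ⊢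
  · rw [← h3.1, ← h3.2]; exact h
  · rw [← h3.1, ← h3.2]; exact h
  · rw [← h3.1, ← h3.2]; exact h
  · exact h

theorem RTTRel.map {C : Type*} [Ring C] [Algebra k C] (g : B →ₐ[k] C) {z : ℕ → ℕ → B}
    {i s j l : ℕ} (h : RTTRel q z i s j l) : RTTRel q (fun i j => g (z i j)) i s j l := by
  have := congrArg g h
  simp only [map_add, map_smul, map_mul, apply_ite g, map_zero] at this
  exact this

theorem RTTRel.of_map {C : Type*} [Ring C] [Algebra k C] {g : B →ₐ[k] C}
    (hg : Function.Injective g) {z : ℕ → ℕ → B} {i s j l : ℕ}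
    (h : RTTRel q (fun i j => g (z i j)) i s j l) : RTTRel q z i s j l := by
  apply hg
  simp only [map_add, map_smul, map_mul, apply_ite g, map_zero]
  exact h

theorem exists_matrix_inv_of_isUnit_genMinor (hq : q ≠ 0) {t : ℕ}
    {X : Matrix (Fin (t + 1)) (Fin (t + 1)) B} (hX : IsQMat q X)
    (hd : IsUnit (genMinor q X id id)) : ∃ Y, X * Y = 1 ∧ Y * X = 1 := by
  obtain ⟨u, hu⟩ := hd
  have hA : X * Matrix.of (qAdj q X) = Matrix.diagonal fun _ => (u : B) := by
    ext a c
    simp only [Matrix.mul_apply, Matrix.of_apply, Matrix.diagonal_apply, hu]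
    exact sum_mul_qAdj hq hX a c
  have hB : Matrix.of (qAdj q X) * X = Matrix.diagonal fun _ => (u : B) := by
    ext a c
    simp only [Matrix.mul_apply, Matrix.of_apply, Matrix.diagonal_apply, hu]
    exact sum_qAdj_mul hq hX a c
  have h1 : X * (Matrix.of (qAdj q X) * Matrix.diagonal fun _ => ((u⁻¹ : Bˣ) : B)) = 1 := by
    rw [← mul_assoc, hA, Matrix.diagonal_mul_diagonal]
    simp
  have h2 : (Matrix.diagonal fun _ => ((u⁻¹ : Bˣ) : B)) * Matrix.of (qAdj q X) * X = 1 := by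
    rw [mul_assoc, hB, Matrix.diagonal_mul_diagonal]
    simp
  exact ⟨_, h1, left_inv_eq_right_inv h2 h1 ▸ h2⟩

end

section
variable {k : Type} [Field k] {q : k} {n r : ℕ}

/-- The generators of `A_{n,r}`, extended by zero. -/
noncomputable def AsubGen (k : Type) [Field k] (q : k) (n r : ℕ) (i j : ℕ) : Asub k q n r :=
  if h : i < n ∧ j < n ∧ (i < r ∨ j < r) then
    ⟨Zgen k q n n ⟨i, h.1⟩ ⟨j, h.2.1⟩, Zgen_mem_Asub h.2.2⟩ else 0

theorem AsubGen_rttRel (hq : q ≠ 0) {i s j l : ℕ} (hi : i < n) (hs : s < n) (hj : j < n)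
    (hl : l < n) (h : i < r ∧ s < r ∨ j < r ∧ l < r ∨ i < r ∧ l < r) :
    RTTRel q (AsubGen k q n r) i s j l := by
  have hA : ∀ {a b : ℕ} (ha : a < n) (hb : b < n), (a < r ∨ b < r) →
      (if h : a < n ∧ b < n then Zgen k q n n ⟨a, h.1⟩ ⟨b, h.2⟩ else 0) =
        (Asub k q n r).val (AsubGen k q n r a b) := by
    intro a b ha hb hab
    rw [AsubGen, dif_pos (show a < n ∧ b < n from ⟨ha, hb⟩),
      dif_pos (show a < n ∧ b < n ∧ (a < r ∨ b < r) from ⟨ha, hb, hab⟩)]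
    rfl
  have := (isQMat_Zgen k q n n).rttRel hq
    (z := fun a b => if h : a < n ∧ b < n then Zgen k q n n ⟨a, h.1⟩ ⟨b, h.2⟩ else 0)
    (fun i j => by simp) ⟨i, hi⟩ ⟨s, hs⟩ ⟨j, hj⟩ ⟨l, hl⟩
  have hij : i < r ∨ j < r := by omega
  have hsl : s < r ∨ l < r := by omega
  have hsj : s < i ∨ j < l → s < r ∨ j < r := by omega
  have hil : s < i ∨ j < l → i < r ∨ l < r := by omega
  exact RTTRel.of_map (g := (Asub k q n r).val) Subtype.val_injective
    (this.congr (hA hi hj hij) (hA hs hl hsl)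
      fun h' => ⟨hA hs hj (hsj h'), hA hi hl (hil h')⟩)

theorem genMinor_AsubGen (h : r ≤ n) :
    genMinor q (fun i j : Fin r => AsubGen k q n r i j) id id =
      ⟨dMinor k q n r h, dMinor_mem_Asub h⟩ := by
  apply Subtype.ext
  change (Asub k q n r).val _ = genMinor q (Zgen k q n n) (Fin.castLE h) (Fin.castLE h)
  refine (map_genMinor (B := Asub k q n r) (C := QMat k q n n) q
    (Asub k q n r).val _ _ _).trans ?_
  unfold genMinor
  refine Finset.sum_congr rfl fun σ _ => ?_
  congr 3
  funext a
  have ha : ((a : ℕ) < n ∧ (σ a : ℕ) < n ∧ ((a : ℕ) < r ∨ (σ a : ℕ) < r)) := by omega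
  simp only [id_eq, AsubGen, dif_pos ha]
  rfl

/-- An algebra homomorphism from `A_{n,r}` inverting `d` extends along `π`. -/
theorem exists_extension_of_isUnit (hq : q ≠ 0) (hr : 1 ≤ r) (hrn : r ≤ n) {B : Type} [Ring B]
    [Algebra k B] (f : Asub k q n r →ₐ[k] B)
    (hd : IsUnit (f ⟨dMinor k q n r hrn, dMinor_mem_Asub hrn⟩)) :
    ∃ g : QMatRank k q n r →ₐ[k] B, ∀ x : Asub k q n r, g (rankProj k q n r x) = f x := by
  obtain ⟨t, rfl⟩ : ∃ t, r = t + 1 := ⟨r - 1, by omega⟩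
  set z : ℕ → ℕ → B := fun i j => f (AsubGen k q n (t + 1) i j) with hz
  have hrel : ∀ i s j l, i < n → s < n → j < n → l < n →
      (i < t + 1 ∧ s < t + 1 ∨ j < t + 1 ∧ l < t + 1 ∨ i < t + 1 ∧ l < t + 1) →
      RTTRel q z i s j l := fun i s j l hi hs hj hl h =>
    (AsubGen_rttRel hq hi hs hj hl h).map f
  let X : Matrix (Fin (t + 1)) (Fin (t + 1)) B := Matrix.of fun i j => z i j
  let P : Matrix (Fin n) (Fin (t + 1)) B := Matrix.of fun i j => z i j
  let Q : Matrix (Fin (t + 1)) (Fin n) B := Matrix.of fun i j => z i j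
  have hX : IsQMat q X := isQMat_of_rttRel hq fun i s j l =>
    hrel _ _ _ _ (by omega) (by omega) (by omega) (by omega) (Or.inl ⟨i.2, s.2⟩)
  have hdX : genMinor q X id id = f ⟨dMinor k q n (t + 1) hrn, dMinor_mem_Asub hrn⟩ := by
    rw [← genMinor_AsubGen]
    exact (map_genMinor q f (fun i j : Fin (t + 1) => AsubGen k q n (t + 1) i j) id id).symm
  obtain ⟨Y, hXY, hYX⟩ := exists_matrix_inv_of_isUnit_genMinor hq hX (hdX ▸ hd)
  set T : Matrix (Fin n) (Fin n) B := P * Y * Q with hTdef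
  have hT : IsQMat q T := by
    have := isQMat_of_rttRel hq
      (z := fun i j => if h : i < n ∧ j < n then T ⟨i, h.1⟩ ⟨j, h.2⟩ else 0)
      (rttRel_mul_inv_mul hq hrn hrel (X := X) (P := P) (Q := Q) (fun _ _ => rfl) (fun _ _ => rfl)
        (fun _ _ => rfl) hXY hYX (fun i j => by simp [hTdef]))
    simpa using this
  have hrow : ∀ (i : Fin (t + 1)) (j : Fin n), T (Fin.castLE hrn i) j = z i j := by
    intro i j
    have : T (Fin.castLE hrn i) j = (X * Y * Q) i j := rfl
    rw [this, hXY, Matrix.one_mul]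
    rfl
  have hcol : ∀ (i : Fin n) (j : Fin (t + 1)), T i (Fin.castLE hrn j) = z i j := by
    intro i j
    have : T i (Fin.castLE hrn j) = (P * (Y * X)) i j := by
      rw [hTdef, ← Matrix.mul_assoc]
      rfl
    rw [this, hYX, Matrix.mul_one]
    rfl
  have hw : ∀ i j, T i j = ∑ c, (P * Y) i c * T (Fin.castLE hrn c) j := by
    intro i j
    simp only [hrow]
    exact Matrix.mul_apply
  obtain ⟨g, hg⟩ := hT.exists_algHom
  have hg0 : ∀ ⦃a b⦄, minorRel k q n (t + 1 + 1) a b → g a = g b := by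
    rintro _ _ ⟨⟨ro, co, -, hco, rfl⟩, rfl⟩
    rw [map_zero]
    change g (genMinor q (Zgen k q n n) ro co) = 0
    rw [map_genMinor]
    simp only [hg]
    exact genMinor_eq_zero_of_row_combination hq hrn hT _ hw ro hco
  refine ⟨RingQuot.liftAlgHom k ⟨g, hg0⟩, fun x => ?_⟩
  rw [rankProj, RingQuot.liftAlgHom_mkAlgHom_apply]
  have := Asub_hom_rel (f := g.comp (Asub k q n (t + 1)).val) (g := f) (c := 1) (fun i j hij => by
    rw [one_mul, mul_one]
    change g (Zgen k q n n i j) = _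
    have hzij : f ⟨Zgen k q n n i j, Zgen_mem_Asub hij⟩ = z i j := by
      have h : (i : ℕ) < n ∧ (j : ℕ) < n ∧ ((i : ℕ) < t + 1 ∨ (j : ℕ) < t + 1) :=
        ⟨i.2, j.2, hij⟩
      simp only [hz, AsubGen]
      rw [dif_pos h]
    rw [hg, hzij]
    rcases hij with h | h
    · exact hrow ⟨i, h⟩ j
    · exact hcol i ⟨j, h⟩) x
  simpa using this

theorem exists_rankProj_dMinor_mul_Zgen (hrn : r ≤ n) {i j : Fin n} (hi : r ≤ (i : ℕ))
    (hj : r ≤ (j : ℕ)) :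
    ∃ x : Asub k q n r, rankProj k q n r (dMinor k q n r hrn * Zgen k q n n i j) =
      rankProj k q n r x := by
  have hmono : ∀ i : Fin n, r ≤ (i : ℕ) →
      StrictMono (Fin.snoc (α := fun _ => Fin n) (Fin.castLE hrn) i) := by
    intro i hi a b
    refine Fin.lastCases ?_ (fun b => ?_) b <;> refine Fin.lastCases ?_ (fun a => ?_) a
    · simp
    · intro _
      simp only [Fin.snoc_castSucc, Fin.snoc_last, Fin.lt_def, Fin.val_castLE]
      omega
    · intro h
      exact absurd h (not_lt_of_ge (Fin.le_last _))
    · simp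
  have hcomp : ∀ i : Fin n, Fin.snoc (α := fun _ => Fin n) (Fin.castLE hrn) i ∘ Fin.castSucc =
      Fin.castLE hrn := fun i => funext fun a => by simp
  have h0 : rankProj k q n r (genMinor q (Zgen k q n n)
      (Fin.snoc (α := fun _ => Fin n) (Fin.castLE hrn) i)
      (Fin.snoc (α := fun _ => Fin n) (Fin.castLE hrn) j)) = 0 := by
    rw [← map_zero (rankProj k q n r)]
    exact RingQuot.mkAlgHom_rel k ⟨⟨_, _, hmono i hi, hmono j hj, rfl⟩, rfl⟩
  rw [genMinor_succ_last, Fin.sum_univ_castSucc, map_add, Fin.snoc_last, Fin.snoc_last, hcomp,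
    Fin.succAbove_last, hcomp, Fin.val_last, Nat.sub_self, pow_zero, one_smul] at h0
  obtain ⟨y, hy, h1⟩ : ∃ y ∈ Asub k q n r, rankProj k q n r y +
      rankProj k q n r (dMinor k q n r hrn * Zgen k q n n i j) = 0 := by
    refine ⟨_, ?_, h0⟩
    refine Subalgebra.sum_mem _ fun p _ => Subalgebra.smul_mem _ (Subalgebra.mul_mem _ ?_ ?_) _
    · exact genMinor_mem_Asub fun a _ => Or.inl a.2
    · exact Zgen_mem_Asub (Or.inr (by simp))
  exact ⟨-⟨y, hy⟩, (eq_neg_of_add_eq_zero_right h1).trans (map_neg _ _).symm⟩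

theorem exists_dMinor_pow_mul (hq : q ≠ 0) (hr : 1 ≤ r) (hrn : r ≤ n) (m : QMatRank k q n r) :
    ∃ (N : ℕ) (x : Asub k q n r), rankProj k q n r (dMinor k q n r hrn) ^ N * m =
      rankProj k q n r x := by
  obtain ⟨τ, -, -, hτ, -⟩ := exists_dMinor_twist hq hr hrn
  obtain ⟨y, rfl⟩ := RingQuot.mkAlgHom_surjective k (minorRel k q n (r + 1)) m
  obtain ⟨a, rfl⟩ := RingQuot.mkAlgHom_surjective k (QMatRel k q n n) y
  have hcomm : ∀ (N : ℕ) (x : Asub k q n r), rankProj k q n r (dMinor k q n r hrn) ^ N *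
      rankProj k q n r x = rankProj k q n r (τ^[N] x : Asub k q n r) *
        rankProj k q n r (dMinor k q n r hrn) ^ N := by
    intro N x
    have := congrArg (fun x : Asub k q n r => rankProj k q n r x)
      (pow_mul_eq_of_normal hτ N x)
    simpa only [Subalgebra.coe_mul, Subalgebra.coe_pow, map_mul, map_pow] using this
  change ∃ (N : ℕ) (x : Asub k q n r), rankProj k q n r (dMinor k q n r hrn) ^ N *
    rankProj k q n r (RingQuot.mkAlgHom k (QMatRel k q n n) a) = rankProj k q n r x
  induction a using FreeAlgebra.induction with
  | grade0 c => exact ⟨0, algebraMap k _ c, by simp⟩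
  | grade1 p =>
    obtain ⟨i, j⟩ := p
    change ∃ (N : ℕ) (x : Asub k q n r), _ * rankProj k q n r (Zgen k q n n i j) = _
    by_cases h : (i : ℕ) < r ∨ (j : ℕ) < r
    · exact ⟨0, ⟨_, Zgen_mem_Asub h⟩, by simp⟩
    · obtain ⟨x, hx⟩ := exists_rankProj_dMinor_mul_Zgen (q := q) hrn (i := i) (j := j)
        (by omega) (by omega)
      exact ⟨1, x, by rw [pow_one, ← map_mul, hx]⟩
  | mul a b ha hb =>
    obtain ⟨M, x, hx⟩ := ha
    obtain ⟨N, y, hy⟩ := hb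
    refine ⟨N + M, τ^[N] x * y, ?_⟩
    rw [map_mul, map_mul, pow_add, mul_assoc, ← mul_assoc _ _ (rankProj k q n r _), hx, ← mul_assoc,
      hcomm, mul_assoc, hy, Subalgebra.coe_mul, map_mul]
  | add a b ha hb =>
    obtain ⟨M, x, hx⟩ := ha
    obtain ⟨N, y, hy⟩ := hb
    refine ⟨M + N, ⟨dMinor k q n r hrn, dMinor_mem_Asub hrn⟩ ^ N * x +
      ⟨dMinor k q n r hrn, dMinor_mem_Asub hrn⟩ ^ M * y, ?_⟩
    simp only [Subalgebra.coe_add, Subalgebra.coe_mul, Subalgebra.coe_pow, map_add, map_mul,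
      map_pow, ← hx, ← hy, mul_add, ← mul_assoc, ← pow_add, add_comm N M]

theorem pow_mem_powerSet (hrn : r ≤ n) (N : ℕ) :
    dMinor k q n r hrn ^ N ∈ powerSet k q n r hrn :=
  ⟨0, N, by simp⟩

theorem isUnit_of_mem_powerSet (hq : q ≠ 0) (hrn : r ≤ n) {B : Type*} [Ring B] [Algebra k B]
    (f : Asub k q n r →ₐ[k] B) (hd : IsUnit (f ⟨dMinor k q n r hrn, dMinor_mem_Asub hrn⟩))
    {s : Asub k q n r} (hs : (s : QMat k q n n) ∈ powerSet k q n r hrn) : IsUnit (f s) := by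
  obtain ⟨i, j, h⟩ := hs
  have : s = q⁻¹ ^ i • (⟨dMinor k q n r hrn, dMinor_mem_Asub hrn⟩ : Asub k q n r) ^ j :=
    Subtype.ext h
  rw [this, map_smul, map_pow]
  exact (hd.pow j).smul (Units.mk0 (q⁻¹ ^ i) (pow_ne_zero _ (inv_ne_zero hq)))

theorem powerSet_subset_Asub (hrn : r ≤ n) : powerSet k q n r hrn ⊆ Asub k q n r := by
  rintro _ ⟨i, j, rfl⟩
  exact Subalgebra.smul_mem _ (Subalgebra.pow_mem _ (dMinor_mem_Asub hrn) _) _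

end

/-- Let `k` have characteristic zero and let `q ≠ 0` be generic or a
primitive root of unity.  For `1 ≤ r ≤ n - 1`, the natural map
`π : A_{n,r} → M^{r+1}_q(n)` induces an isomorphism of `k`-algebras
`A_{n,r}[d⁻¹] ≅ M^{r+1}_q(n)[d⁻¹]`, where both sides are the Ore localizations at
`S = {q^{-i} d^j}` (respectively at `π(S)`). -/
theorem Asub_loc_iso_QMatRank_loc
    (k : Type) [Field k] [CharZero k] (q : k) (hq0 : q ≠ 0)
    (hq : GenericOrRootOfUnity k q) (n r : ℕ) (hr : 1 ≤ r) (hrn : r + 1 ≤ n) :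
    ∃ (B B' : Type) (_ : Ring B) (_ : Ring B') (_ : Algebra k B) (_ : Algebra k B')
      (fA : Asub k q n r →ₐ[k] B) (fM : QMatRank k q n r →ₐ[k] B') (φ : B ≃ₐ[k] B'),
      IsOreLocalization (fA : Asub k q n r →+* B)
        {x : Asub k q n r | (x : QMat k q n n) ∈ powerSet k q n r (le_of_lt hrn)} ∧
      IsOreLocalization (fM : QMatRank k q n r →+* B')
        (rankProj k q n r '' powerSet k q n r (le_of_lt hrn)) ∧
      ∀ x : Asub k q n r, φ (fA x) = fM (rankProj k q n r (x : QMat k q n n)) := by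
  have hrn' : r ≤ n := le_of_lt hrn
  obtain ⟨τ, τ', hτ, hd, hd'⟩ := exists_dMinor_twist hq0 hr hrn'
  obtain ⟨B, _, _, f, hf, hfr, hfl, hf0⟩ :=
    exists_localization_of_normal (k := k) (A := Asub k q n r)
      (τ := (τ : Asub k q n r →+* Asub k q n r)) (τ' := τ') hτ hd hd'
  obtain ⟨g, hg⟩ := exists_extension_of_isUnit hq0 hr hrn' f hf
  have hS : ∀ N, ((⟨dMinor k q n r hrn', dMinor_mem_Asub hrn'⟩ : Asub k q n r) ^ N :
      Asub k q n r) ∈ {x : Asub k q n r | (x : QMat k q n n) ∈ powerSet k q n r hrn'} :=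
    fun N => pow_mem_powerSet hrn' N
  have hS' : ∀ N, rankProj k q n r (dMinor k q n r hrn') ^ N ∈
      rankProj k q n r '' powerSet k q n r hrn' :=
    fun N => ⟨_, pow_mem_powerSet hrn' N, map_pow _ _ _⟩
  have hgd : g (rankProj k q n r (dMinor k q n r hrn')) = f ⟨_, dMinor_mem_Asub hrn'⟩ := hg ⟨_, _⟩
  refine ⟨B, B, _, _, _, _, f, g, AlgEquiv.refl, ⟨?_, ?_, ?_, ?_⟩, ⟨?_, ?_, ?_, ?_⟩,
    fun x => (hg x).symm⟩
  · exact fun s hs => isUnit_of_mem_powerSet hq0 hrn' f hf hs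
  · intro b
    obtain ⟨a, N, h⟩ := hfr b
    exact ⟨a, _, hS N, (congrArg _ (map_pow f _ N)).trans h⟩
  · intro b
    obtain ⟨a, N, h⟩ := hfl b
    exact ⟨a, _, hS N, (congrArg (· * b) (map_pow f _ N)).trans h⟩
  · intro a ha
    obtain ⟨N, h⟩ := hf0 a ha
    exact ⟨_, hS N, Or.inr h⟩
  · rintro _ ⟨s, hs, rfl⟩
    have := isUnit_of_mem_powerSet hq0 hrn' f hf (s := ⟨s, powerSet_subset_Asub hrn' hs⟩) hs
    rwa [← hg] at this
  · intro b
    obtain ⟨a, N, h⟩ := hfr b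
    exact ⟨rankProj k q n r a, _, hS' N, by simpa [hg, hgd] using h⟩
  · intro b
    obtain ⟨a, N, h⟩ := hfl b
    exact ⟨rankProj k q n r a, _, hS' N, by simpa [hg, hgd] using h⟩
  · intro m hm
    obtain ⟨N, x, hx⟩ := exists_dMinor_pow_mul hq0 hr hrn' m
    obtain ⟨K, hK⟩ := hf0 x (by
      rw [← hg, ← hx, map_mul, show g m = 0 from hm, mul_zero])
    refine ⟨_, hS' (K + N), Or.inr ?_⟩
    rw [pow_add, mul_assoc, hx]
    have := congrArg (fun y : Asub k q n r => rankProj k q n r y) hK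
    simpa only [Subalgebra.coe_mul, Subalgebra.coe_pow, map_mul, map_pow, Subalgebra.coe_zero,
      map_zero] using this
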